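/- arXiv:2305.15625 — 2 statements merged into one kernel-verified Lean document; each statement's English description precedes it below -/
import Mathlib

section
/- Let G = (V, E) be a finite simple claw-free graph with an operator realization. Then for every even hole C₀ of G, every k ≥ 0, and every token-sliding class μ of size-k independent sets of G, the generalized cycle symmetry commutes with the token-sliding charge: J_{⟨C₀⟩}(G)·Q_{k,μ}(G) = Q_{k,μ}(G)·J_{⟨C₀⟩}(G). (Theorem 1(ii).) -/
open scoped Classical

universe u

/-- `G` is claw-free: no vertex has three pairwise distinct, pairwise non-adjacent neighbors. -/
def ClawFree {V : Type u} (G : SimpleGraph V) : Prop :=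
  ¬ ∃ c x y z : V, x ≠ y ∧ x ≠ z ∧ y ≠ z ∧
    G.Adj c x ∧ G.Adj c y ∧ G.Adj c z ∧ ¬ G.Adj x y ∧ ¬ G.Adj x z ∧ ¬ G.Adj y z

/-- `S` is an independent set of `G`. -/
def IsIndep {V : Type u} (G : SimpleGraph V) (S : Finset V) : Prop :=
  ∀ u ∈ S, ∀ v ∈ S, ¬ G.Adj u v

/-- The product `h(S) = ∏_{v ∈ S} h v`, well defined when the factors pairwise commute. -/
noncomputable def hProd {V : Type u} {d : ℕ} (h : V → Matrix (Fin d) (Fin d) ℂ)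
    (S : Finset V) : Matrix (Fin d) (Fin d) ℂ :=
  if hc : (S : Set V).Pairwise fun u v => Commute (h u) (h v) then S.noncommProd h hc
  else 0

/-- `C` induces a cycle of length at least 4 in `G`: it has at least four vertices, the
induced subgraph is connected, and every vertex of `C` has exactly two neighbors in `C`. -/
def IsHole {V : Type u} [DecidableEq V] (G : SimpleGraph V) (C : Finset V) : Prop :=
  4 ≤ C.card ∧ (G.induce (C : Set V)).Connected ∧
    ∀ v ∈ C, (C.filter fun u => G.Adj v u).card = 2

/-- `C` is an even hole of `G`: it induces a cycle of even length at least 4. -/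
def IsEvenHole {V : Type u} [DecidableEq V] (G : SimpleGraph V) (C : Finset V) : Prop :=
  IsHole G C ∧ Even C.card

/-- The operator `h(C) = h(C_a)·h(C_b)` associated to an even hole `C`, where `C_a, C_b` are
the two bipartition classes of `C`: a partition of `C` into two disjoint independent sets.
(For an even hole this partition is unique up to swapping the two classes, and the two
resulting products agree under an operator realization.) -/
noncomputable def holeOp {V : Type u} {d : ℕ} [DecidableEq V] (G : SimpleGraph V)
    (h : V → Matrix (Fin d) (Fin d) ℂ) (C : Finset V) : Matrix (Fin d) (Fin d) ℂ :=
  if hx : ∃ p : Finset V × Finset V, p.1 ∪ p.2 = C ∧ Disjoint p.1 p.2 ∧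
      IsIndep G p.1 ∧ IsIndep G p.2 then
    hProd h hx.choose.1 * hProd h hx.choose.2
  else 0

/-- `L'` is the single-vertex deformation of `L` by a vertex `j ∉ L` whose neighborhood in `L`
consists of a vertex `k` together with the two neighbors of `k` within `L`; then
`L' = (L \ {k}) ∪ {j}`. -/
def SingleVertexDeform {V : Type u} [DecidableEq V] (G : SimpleGraph V)
    (L L' : Finset V) : Prop :=
  ∃ j k, j ∉ L ∧ k ∈ L ∧
    (L.filter fun u => G.Adj j u) = insert k (L.filter fun u => G.Adj k u) ∧
    (L.filter fun u => G.Adj k u).card = 2 ∧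
    L' = insert j (L.erase k)

/-- The deformation closure `⟨C₀⟩` of an even hole `C₀`: all even holes obtainable from `C₀`
by a finite sequence of single-vertex deformations. -/
noncomputable def deformClosure {V : Type u} [Fintype V] [DecidableEq V]
    (G : SimpleGraph V) (C₀ : Finset V) : Finset (Finset V) :=
  Finset.univ.filter fun C =>
    IsEvenHole G C ∧ Relation.ReflTransGen (SingleVertexDeform G) C₀ C

/-- The generalized cycle symmetry `J_{⟨C₀⟩}(G) = Σ_{C ∈ ⟨C₀⟩} h(C)`. -/
noncomputable def cycleSymm {V : Type u} {d : ℕ} [Fintype V] [DecidableEq V]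
    (G : SimpleGraph V) (h : V → Matrix (Fin d) (Fin d) ℂ) (C₀ : Finset V) :
    Matrix (Fin d) (Fin d) ℂ :=
  ∑ C ∈ deformClosure G C₀, holeOp G h C

/-- Two independent sets are related by a token slide. -/
def TokenSlide {V : Type u} [DecidableEq V] (G : SimpleGraph V) (S S' : Finset V) : Prop :=
  IsIndep G S ∧ IsIndep G S' ∧
    ∃ u v, G.Adj u v ∧ u ∈ S ∧ u ∉ S' ∧ v ∈ S' ∧ v ∉ S ∧ S' = insert v (S.erase u)

/-- `μ` is a token-sliding class of size-`k` independent sets of `G`. -/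
def IsTokenClass {V : Type u} [Fintype V] [DecidableEq V] (G : SimpleGraph V) (k : ℕ)
    (μ : Finset (Finset V)) : Prop :=
  ∃ S₀ : Finset V, IsIndep G S₀ ∧ S₀.card = k ∧
    ∀ S, S ∈ μ ↔ Relation.EqvGen (TokenSlide G) S₀ S

/-- The token-sliding charge `Q_{k,μ}(G) = Σ_{S ∈ μ} h(S)`. -/
noncomputable def tokenCharge {V : Type u} {d : ℕ} (h : V → Matrix (Fin d) (Fin d) ℂ)
    (μ : Finset (Finset V)) : Matrix (Fin d) (Fin d) ℂ :=
  ∑ S ∈ μ, hProd h S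

namespace ClawFreeSymmetry

section Neighbors

variable {V : Type u} {G : SimpleGraph V}

/-- The neighbors of `v` that lie in `X`. -/
noncomputable def nbrIn (G : SimpleGraph V) (X : Finset V) (v : V) : Finset V :=
  X.filter fun u => G.Adj v u

@[simp] lemma mem_nbrIn {X : Finset V} {v w : V} : w ∈ nbrIn G X v ↔ w ∈ X ∧ G.Adj v w := by
  simp [nbrIn]

lemma adj_of_clawFree (hcf : ClawFree G) {c x y z : V} (hx : G.Adj c x) (hy : G.Adj c y)
    (hz : G.Adj c z) (hxy : x ≠ y) (hxz : x ≠ z) (hyz : y ≠ z) :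
    G.Adj x y ∨ G.Adj x z ∨ G.Adj y z := by
  by_contra! H
  exact hcf ⟨c, x, y, z, hxy, hxz, hyz, hx, hy, hz, H.1, H.2.1, H.2.2⟩

lemma eq_of_three_nbrs (hcf : ClawFree G) {X : Finset V} (hX : IsIndep G X) {c x y z : V}
    (hx : x ∈ X) (hy : y ∈ X) (hz : z ∈ X) (hcx : G.Adj c x) (hcy : G.Adj c y)
    (hcz : G.Adj c z) : x = y ∨ x = z ∨ y = z := by
  by_contra! H
  rcases adj_of_clawFree hcf hcx hcy hcz H.1 H.2.1 H.2.2 with h | h | h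
  · exact hX _ hx _ hy h
  · exact hX _ hx _ hz h
  · exact hX _ hy _ hz h

lemma card_nbrIn_le_two (hcf : ClawFree G) {X : Finset V} (hX : IsIndep G X) (v : V) :
    (nbrIn G X v).card ≤ 2 := by
  by_contra! H
  obtain ⟨x, y, z, hx, hy, hz, hxy, hxz, hyz⟩ := Finset.two_lt_card_iff.1 H
  simp only [mem_nbrIn] at hx hy hz
  rcases eq_of_three_nbrs hcf hX hx.1 hy.1 hz.1 hx.2 hy.2 hz.2 with h | h | h <;> contradiction

/-- `A` and `B` are the two classes of a disjoint union of induced even cycles. -/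
structure IsBicycle (G : SimpleGraph V) (A B : Finset V) : Prop where
  indepA : IsIndep G A
  indepB : IsIndep G B
  disj : Disjoint A B
  degA : ∀ a ∈ A, (nbrIn G B a).card = 2
  degB : ∀ b ∈ B, (nbrIn G A b).card = 2

lemma IsBicycle.symm {A B : Finset V} (hC : IsBicycle G A B) : IsBicycle G B A :=
  ⟨hC.indepB, hC.indepA, hC.disj.symm, hC.degB, hC.degA⟩

lemma IsBicycle.notMem_right {A B : Finset V} (hC : IsBicycle G A B) {v : V} (hv : v ∈ A) :
    v ∉ B := Finset.disjoint_left.1 hC.disj hv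

lemma IsBicycle.exists_common_nbr (hcf : ClawFree G) {A B : Finset V} (hC : IsBicycle G A B)
    {a s : V} (ha : a ∈ A) (hs : s ∉ B) (hsa : G.Adj s a) :
    ∃ b ∈ B, G.Adj a b ∧ G.Adj s b := by
  obtain ⟨x, y, hxy, hn⟩ := Finset.card_eq_two.1 (hC.degA a ha)
  have hx : x ∈ nbrIn G B a := by simp [hn]
  have hy : y ∈ nbrIn G B a := by simp [hn]
  rw [mem_nbrIn] at hx hy
  rcases adj_of_clawFree hcf hsa.symm hx.2 hy.2 (by grind) (by grind) hxy with h | h | h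
  · exact ⟨x, hx.1, hx.2, h⟩
  · exact ⟨y, hy.1, hy.2, h⟩
  · exact absurd h (hC.indepB _ hx.1 _ hy.1)

lemma sum_nbrIn_comm (P Q : Finset V) :
    ∑ s ∈ P, (nbrIn G Q s).card = ∑ c ∈ Q, (nbrIn G P c).card := by
  have := Finset.sum_card_bipartiteAbove_eq_sum_card_bipartiteBelow (s := P) (t := Q)
    (fun a b => G.Adj a b)
  simp only [Finset.bipartiteAbove, Finset.bipartiteBelow] at this
  simp only [nbrIn]
  rw [this]
  simp only [G.adj_comm]

lemma mem_reverse_swap {l : List (V × V)} {p : V × V} :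
    p ∈ (l.map Prod.swap).reverse ↔ p.swap ∈ l := by
  rw [List.mem_reverse, List.mem_map]
  exact ⟨by rintro ⟨q, hq, rfl⟩; simpa using hq, fun h => ⟨_, h, Prod.swap_swap p⟩⟩

end Neighbors

section Chains

variable {V : Type u} {G : SimpleGraph V} {A B S : Finset V}

/-- A chain of matched pairs (token of `S`, vertex of `A`), the most recent pair first: it starts at
a token with one neighbor in `A` and two in `B`, and each later token is adjacent to the
`A`-vertex of the preceding pair. -/
inductive TokenChain (G : SimpleGraph V) (A B S : Finset V) : List (V × V) → Prop
  | start {s c : V} : s ∈ S → s ∉ A → s ∉ B → c ∈ A → G.Adj s c →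
      (nbrIn G A s).card = 1 → nbrIn G B s = nbrIn G B c → TokenChain G A B S [(s, c)]
  | step {s c t d : V} {l : List (V × V)} : TokenChain G A B S ((s, c) :: l) → t ∈ S → t ∉ A →
      t ∉ B → t ≠ s → G.Adj t c → d ∈ A → d ≠ c → G.Adj t d → nbrIn G B t = nbrIn G B d →
      TokenChain G A B S ((t, d) :: (s, c) :: l)

lemma TokenChain.pair {l : List (V × V)} (hl : TokenChain G A B S l) :
    ∀ p ∈ l, p.1 ∈ S ∧ p.1 ∉ A ∧ p.1 ∉ B ∧ p.2 ∈ A ∧ G.Adj p.1 p.2 ∧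
      nbrIn G B p.1 = nbrIn G B p.2 := by
  induction hl with
  | start => simp; tauto
  | step _ _ _ _ _ _ _ _ _ _ ih =>
    intro p hp
    rcases List.mem_cons.1 hp with rfl | hp
    · exact ⟨‹_›, ‹_›, ‹_›, ‹_›, ‹_›, ‹_›⟩
    · exact ih p hp

lemma TokenChain.isChain {l : List (V × V)} (hl : TokenChain G A B S l) :
    l.IsChain fun p q => G.Adj q.2 p.1 := by
  induction hl with
  | start => simp
  | step _ _ _ _ _ h _ _ _ _ ih => exact List.IsChain.cons_cons h.symm ih

lemma TokenChain.structure (hcf : ClawFree G) (hA : IsIndep G A) (hS : IsIndep G S)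
    {l : List (V × V)} (hl : TokenChain G A B S l) :
    (∀ p ∈ l, ∀ a ∈ A, G.Adj p.1 a → ∃ q ∈ l, q.2 = a) ∧
    (∀ p ∈ l.tail, ∀ t ∈ S, G.Adj t p.2 → ∃ q ∈ l, q.1 = t) ∧
    l.Pairwise (fun p q => ¬ G.Adj q.1 p.2) ∧ (l.map Prod.fst).Nodup := by
  induction hl with
  | @start s c hs hsA hsB hc hsc h1 hN =>
    refine ⟨?_, by simp, by simp, by simp⟩
    intro p hp a ha hpa
    simp only [List.mem_singleton] at hp
    subst hp
    refine ⟨(s, c), by simp, ?_⟩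
    exact Finset.card_le_one.1 h1.le c (by simp [hc, hsc]) a (by simpa using ⟨ha, hpa⟩)
  | @step s c t d l hl ht htA htB hts htc hd hdc htd hN ih =>
    obtain ⟨h1, h2, h3, h4⟩ := ih
    have hp := hl.pair
    have hsc := (hp (s, c) (by simp))
    rw [List.pairwise_cons] at h3
    have htnew : ∀ p ∈ (s, c) :: l, p.1 ≠ t := by
      intro p hp' e
      rcases List.mem_cons.1 hp' with rfl | hp'
      · exact hts e.symm
      · exact h3.1 p hp' (e ▸ htc)
    refine ⟨?_, ?_, ?_, ?_⟩
    · intro p hp' a ha hpa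
      rcases List.mem_cons.1 hp' with rfl | hp'
      · rcases eq_of_three_nbrs hcf hA hsc.2.2.2.1 hd ha htc htd hpa with h | h | h
        · exact absurd h.symm hdc
        · exact ⟨(s, c), by simp, h⟩
        · exact ⟨(t, d), by simp, h⟩
      · obtain ⟨q, hq, e⟩ := h1 p hp' a ha hpa
        exact ⟨q, by simp [hq], e⟩
    · intro p hp' u hu hup
      rcases List.mem_cons.1 hp' with rfl | hp'
      · rcases eq_of_three_nbrs hcf hS hsc.1 ht hu hsc.2.2.2.2.1.symm htc.symm hup.symm
          with h | h | h
        · exact absurd h.symm hts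
        · exact ⟨(s, c), by simp, h⟩
        · exact ⟨(t, d), by simp, h⟩
      · obtain ⟨q, hq, e⟩ := h2 p hp' u hu hup
        exact ⟨q, by simp [hq], e⟩
    · refine List.pairwise_cons.2 ⟨fun p hp' hpd => ?_, List.pairwise_cons.2 h3⟩
      obtain ⟨q, hq, e⟩ := h1 p hp' d hd hpd
      rcases List.mem_cons.1 hq with rfl | hq
      · exact hdc e.symm
      · obtain ⟨r, hr, e'⟩ := h2 q hq t ht (e ▸ htd)
        exact htnew r hr e'
    · rw [List.map_cons, List.nodup_cons]
      refine ⟨?_, h4⟩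
      simp only [List.mem_map, not_exists, not_and]
      exact fun p hp' => htnew p hp'

lemma TokenChain.odd_sum (hcf : ClawFree G) (hA : IsIndep G A)
    {l : List (V × V)} (hl : TokenChain G A B S l) :
    Odd (l.map fun p => (nbrIn G A p.1).card).sum := by
  induction hl with
  | @start s c hs hsA hsB hc hsc h1 hN => simp [h1]
  | @step s c t d l hl ht htA htB hts htc hd hdc htd hN ih =>
    have h2 : (nbrIn G A t).card = 2 := by
      refine le_antisymm (card_nbrIn_le_two hcf hA t) ?_
      refine Finset.one_lt_card.2 ⟨c, ?_, d, ?_, hdc.symm⟩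
      · simpa using ⟨(hl.pair (s, c) (by simp)).2.2.2.1, htc⟩
      · simpa using ⟨hd, htd⟩
    rw [List.map_cons, List.sum_cons, h2]
    exact even_two.add_odd ih

/-- The part of a chain behind a pair is determined by that pair. -/
lemma TokenChain.tail_unique (hcf : ClawFree G) (hA : IsIndep G A) (hS : IsIndep G S)
    {l : List (V × V)} (hl : TokenChain G A B S l) :
    ∀ {l' : List (V × V)}, TokenChain G A B S l' → l.head? = l'.head? → l = l' := by
  induction hl with
  | @start s c hs hsA hsB hc hsc h1 hN =>
    intro l' hl' hh
    cases hl' with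
    | start => simpa using hh
    | @step s' c' t d l hl ht htA htB hts htc hd hdc htd hN =>
      obtain ⟨rfl, rfl⟩ : s = t ∧ c = d := by simpa using hh
      have := Finset.card_le_one.1 h1.le c (by simp [hc, hsc]) c'
        (by simpa using ⟨(hl.pair (s', c') (by simp)).2.2.2.1, htc⟩)
      exact absurd this hdc
  | @step s c t d l hl ht htA htB hts htc hd hdc htd hN ih =>
    have hp := hl.pair (s, c) (by simp)
    intro l' hl' hh
    cases hl' with
    | @start s' c' hs hsA hsB hc hsc h1 hN =>
      obtain ⟨rfl, rfl⟩ : t = s' ∧ d = c' := by simpa using hh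
      have := Finset.card_le_one.1 h1.le d (by simp [hd, htd]) c (by simpa using ⟨hp.2.2.2.1, htc⟩)
      exact absurd this hdc
    | @step s' c' t' d' l' hm ht' htA' htB' hts' htc' hd' hdc' htd' hN' =>
      obtain ⟨rfl, rfl⟩ : t = t' ∧ d = d' := by simpa using hh
      have hp' := hm.pair (s', c') (by simp)
      obtain rfl : c = c' := by
        rcases eq_of_three_nbrs hcf hA hd hp.2.2.2.1 hp'.2.2.2.1 htd htc htc' with h | h | h
        · exact absurd h hdc
        · exact absurd h hdc'
        · exact h
      obtain rfl : s = s' := by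
        rcases eq_of_three_nbrs hcf hS ht hp.1 hp'.1 htc.symm hp.2.2.2.2.1.symm
          hp'.2.2.2.2.1.symm with h | h | h
        · exact absurd h hts
        · exact absurd h hts'
        · exact h
      rw [ih hm rfl]

/-- A chain can be continued at any further token `t` adjacent to its front, unless `t` has
two neighbors in `A` and one in `B`. -/
lemma TokenChain.extend (hcf : ClawFree G) (hC : IsBicycle G A B) (hS : IsIndep G S)
    {s c : V} {l : List (V × V)} (hl : TokenChain G A B S ((s, c) :: l)) {t : V} (ht : t ∈ S)
    (hts : t ≠ s) (htc : G.Adj t c) :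
    (∃ d, TokenChain G A B S ((t, d) :: (s, c) :: l)) ∨
      t ∉ A ∧ t ∉ B ∧ (nbrIn G A t).card = 2 ∧ (nbrIn G B t).card = 1 := by
  obtain ⟨h1, h2, h3, h4⟩ := hl.structure hcf hC.indepA hS
  obtain ⟨hs, hsA, hsB, hc, hsc, hN⟩ := hl.pair (s, c) (by simp)
  dsimp only at hs hsA hsB hc hsc hN
  have htA : t ∉ A := fun h => hC.indepA _ h _ hc htc
  have htB : t ∉ B := fun h => by
    have : t ∈ nbrIn G B s := by rw [hN]; simpa using ⟨h, htc.symm⟩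
    exact hS _ hs _ ht (mem_nbrIn.1 this).2
  rw [List.pairwise_cons] at h3
  have key : ∀ x ∈ B, G.Adj c x → G.Adj t x → ∀ e ∈ A, G.Adj x e → e ≠ c → G.Adj t e := by
    intro x hx hcx htx e he hxe hec
    have hsx : G.Adj s x := by
      have : x ∈ nbrIn G B s := by rw [hN]; simpa using ⟨hx, hcx⟩
      exact (mem_nbrIn.1 this).2
    rcases adj_of_clawFree hcf htx.symm hsx.symm hxe hts (by grind) (by grind) with h | h | h
    · exact absurd h (hS _ ht _ hs)
    · exact h
    · obtain ⟨q, hq, rfl⟩ := h1 (s, c) (by simp) e he h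
      rcases List.mem_cons.1 hq with rfl | hq'
      · exact absurd rfl hec
      · have hqp := hl.pair q hq
        have hqx : G.Adj q.1 x := by
          have : x ∈ nbrIn G B q.1 := by rw [hqp.2.2.2.2.2]; simpa using ⟨hx, hxe.symm⟩
          exact (mem_nbrIn.1 this).2
        rcases eq_of_three_nbrs hcf hS ht hs hqp.1 htx.symm hsx.symm hqx.symm with h | h | h
        · exact absurd h hts
        · exact absurd (h ▸ htc) (h3.1 q hq')
        · simp only [List.map_cons, List.nodup_cons, List.mem_map, not_exists, not_and] at h4
          exact absurd h.symm (h4.1 q hq')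
  have other : ∀ x ∈ B, G.Adj c x → ∃ e ∈ A, G.Adj x e ∧ e ≠ c := by
    intro x hx hcx
    obtain ⟨e, he, hec⟩ := Finset.exists_mem_ne (by rw [hC.degB x hx]; norm_num) c
    exact ⟨e, (mem_nbrIn.1 he).1, (mem_nbrIn.1 he).2, hec⟩
  obtain ⟨x, hx, hcx, htx⟩ := hC.exists_common_nbr hcf hc htB htc
  obtain ⟨d, hd, hxd, hdc⟩ := other x hx hcx
  have htd := key x hx hcx htx d hd hxd hdc
  have cardA : (nbrIn G A t).card = 2 :=
    le_antisymm (card_nbrIn_le_two hcf hC.indepA t)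
      (Finset.one_lt_card.2 ⟨c, by simp [hc, htc], d, by simp [hd, htd], hdc.symm⟩)
  by_cases hB1 : (nbrIn G B t).card = 1
  · exact Or.inr ⟨htA, htB, cardA, hB1⟩
  left
  have cardB : (nbrIn G B t).card = 2 := by
    have := card_nbrIn_le_two hcf hC.indepB t
    have : 0 < (nbrIn G B t).card := Finset.card_pos.2 ⟨x, by simp [hx, htx]⟩
    omega
  refine ⟨d, hl.step ht htA htB hts htc hd hdc htd (Finset.eq_of_subset_of_card_le ?_ ?_)⟩
  · intro y hy
    obtain ⟨hy, hty⟩ := mem_nbrIn.1 hy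
    refine mem_nbrIn.2 ⟨hy, ?_⟩
    obtain ⟨e, he, hye, hte⟩ := hC.symm.exists_common_nbr hcf hy htA hty
    rcases eq_of_three_nbrs hcf hC.indepA hc hd he htc htd hte with h | h | h
    · exact absurd h.symm hdc
    · subst h
      obtain ⟨e', he', hye', hec'⟩ := other y hy hye.symm
      have hte' := key y hy hye.symm hty e' he' hye' hec'
      rcases eq_of_three_nbrs hcf hC.indepA hc hd he' htc htd hte' with h | h | h
      · exact absurd h.symm hdc
      · exact absurd h.symm hec'
      · exact h ▸ hye'.symm
    · exact h ▸ hye.symm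
  · rw [cardB, hC.degA d hd]

lemma TokenChain.exists_maximal [Fintype V] (hcf : ClawFree G) (hC : IsBicycle G A B)
    (hS : IsIndep G S) (n : ℕ) :
    ∀ {l : List (V × V)}, TokenChain G A B S l → Fintype.card V ≤ l.length + n →
      ∃ s c l', TokenChain G A B S ((s, c) :: l') ∧ l.getLast? = ((s, c) :: l').getLast? ∧
        ((∀ t ∈ S, G.Adj t c → t = s) ∨
          ∃ t ∈ S, t ≠ s ∧ G.Adj t c ∧ t ∉ A ∧ t ∉ B ∧
            (nbrIn G A t).card = 2 ∧ (nbrIn G B t).card = 1) := by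
  induction n with
  | zero =>
    intro l hl hn
    have main : ∀ {l : List (V × V)}, TokenChain G A B S l → l.length ≤ Fintype.card V :=
      fun hl => by simpa using (hl.structure hcf hC.indepA hS).2.2.2.length_le_card
    obtain ⟨⟨s, c⟩, r, rfl⟩ : ∃ p r, l = p :: r := by cases hl <;> simp
    refine ⟨s, c, r, hl, rfl, ?_⟩
    by_contra! H
    obtain ⟨⟨t, ht, htc, hts⟩, H⟩ := H
    rcases hl.extend hcf hC hS ht hts htc with ⟨d, hd⟩ | h
    · have := main hd
      simp only [List.length_cons] at this hn
      omega
    · exact H t ht hts htc h.1 h.2.1 h.2.2.1 h.2.2.2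
  | succ n ih =>
    intro l hl hn
    obtain ⟨⟨s, c⟩, r, rfl⟩ : ∃ p r, l = p :: r := by cases hl <;> simp
    by_cases H : ∃ t ∈ S, t ≠ s ∧ G.Adj t c
    · obtain ⟨t, ht, hts, htc⟩ := H
      rcases hl.extend hcf hC hS ht hts htc with ⟨d, hd⟩ | h
      · obtain ⟨s', c', l', h1, h2, h3⟩ := ih hd (by simp only [List.length_cons] at hn ⊢; omega)
        exact ⟨s', c', l', h1, by simpa using h2, h3⟩
      · exact ⟨s, c, r, hl, rfl, Or.inr ⟨t, ht, hts, htc, h⟩⟩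
    · push Not at H
      exact ⟨s, c, r, hl, rfl, Or.inl fun t ht htc => by_contra fun h => H t ht h htc⟩

end Chains

section Counting

variable {V : Type u} {G : SimpleGraph V} {A B S : Finset V}

/-- The tokens outside the cycles having one neighbor in `A` and two in `B`. -/
noncomputable def oddTokens (G : SimpleGraph V) (A B S : Finset V) : Finset V :=
  S.filter fun s => s ∉ A ∧ s ∉ B ∧ (nbrIn G A s).card = 1 ∧ (nbrIn G B s).card = 2

lemma exists_chain_of_mem_oddTokens (hcf : ClawFree G) (hC : IsBicycle G A B) {s : V}
    (hs : s ∈ oddTokens G A B S) : ∃ c, TokenChain G A B S [(s, c)] := by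
  obtain ⟨hs, hsA, hsB, h1, h2⟩ := Finset.mem_filter.1 hs
  obtain ⟨c, hc⟩ := Finset.card_eq_one.1 h1
  have hc' : c ∈ nbrIn G A s := by simp [hc]
  rw [mem_nbrIn] at hc'
  refine ⟨c, .start hs hsA hsB hc'.1 hc'.2 h1 (Finset.eq_of_subset_of_card_le ?_ ?_)⟩
  · intro x hx
    obtain ⟨hx, hsx⟩ := mem_nbrIn.1 hx
    obtain ⟨e, he, hxe, hse⟩ := hC.symm.exists_common_nbr hcf hx hsA hsx
    have : e ∈ nbrIn G A s := by simp [he, hse]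
    rw [hc, Finset.mem_singleton] at this
    exact mem_nbrIn.2 ⟨hx, this ▸ hxe.symm⟩
  · rw [h2, hC.degA c hc'.1]

lemma exists_terminal_chain [Fintype V] (hcf : ClawFree G) (hC : IsBicycle G A B)
    (hS : IsIndep G S) (hlt : (oddTokens G B A S).card < (oddTokens G A B S).card) :
    ∃ s c l, TokenChain G A B S ((s, c) :: l) ∧ ∀ t ∈ S, G.Adj t c → t = s := by
  by_contra! H
  refine hlt.not_ge (Finset.card_le_card_of_forall_subsingleton
    (fun a t => ∃ s c l e, TokenChain G A B S ((s, c) :: l) ∧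
      ((s, c) :: l).getLast? = some (a, e) ∧ t ≠ s ∧ G.Adj t c) ?_ ?_)
  · intro a ha
    obtain ⟨e, he⟩ := exists_chain_of_mem_oddTokens hcf hC ha
    obtain ⟨s, c, l, hl, hlast, h | ⟨t, ht, hts, htc, htA, htB, h2, h1⟩⟩ :=
      he.exists_maximal hcf hC hS (Fintype.card V) (by simp)
    · obtain ⟨t, ht, htc, hts⟩ := H s c l hl
      exact absurd (h t ht htc) hts
    · refine ⟨t, Finset.mem_filter.2 ⟨ht, htB, htA, h1, h2⟩, s, c, l, e, hl, ?_, hts, htc⟩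
      rw [← hlast]; rfl
  · rintro t ht a ⟨-, s, c, l, e, hl, hlast, hts, htc⟩ a'
      ⟨-, s', c', l', e', hl', hlast', hts', htc'⟩
    obtain ⟨ht, htB, htA, h1, h2⟩ := Finset.mem_filter.1 ht
    have hp := hl.pair (s, c) (by simp)
    have hp' := hl'.pair (s', c') (by simp)
    dsimp only at hp hp'
    obtain ⟨x, hx, hcx, htx⟩ := hC.exists_common_nbr hcf hp.2.2.2.1 htB htc
    obtain ⟨x', hx', hcx', htx'⟩ := hC.exists_common_nbr hcf hp'.2.2.2.1 htB htc'
    obtain rfl : x = x' := Finset.card_le_one.1 h1.le x (by simp [hx, htx]) x' (by simp [hx', htx'])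
    have adj_of : ∀ {u v}, nbrIn G B u = nbrIn G B v → G.Adj v x → G.Adj u x := by
      intro u v huv hvx
      have : x ∈ nbrIn G B u := by rw [huv]; simpa using ⟨hx, hvx⟩
      exact (mem_nbrIn.1 this).2
    have hsx := adj_of hp.2.2.2.2.2 hcx
    have hsx' := adj_of hp'.2.2.2.2.2 hcx'
    obtain rfl : s = s' := by
      rcases eq_of_three_nbrs hcf hS ht hp.1 hp'.1 htx.symm hsx.symm hsx'.symm with h | h | h
      · exact absurd h hts
      · exact absurd h hts'
      · exact h
    obtain ⟨g1, -, g3, g4⟩ := hl.structure hcf hC.indepA hS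
    obtain rfl : c' = c := by
      by_contra hne
      obtain ⟨q, hq, rfl⟩ := g1 (s, c) (by simp) c' hp'.2.2.2.1 hp'.2.2.2.2.1
      have hqp := hl.pair q hq
      have hqx := adj_of hqp.2.2.2.2.2 hcx'
      have hq' : q ∈ l := by
        rcases List.mem_cons.1 hq with rfl | hq
        · exact absurd rfl hne
        · exact hq
      rcases eq_of_three_nbrs hcf hS ht hp.1 hqp.1 htx.symm hsx.symm hqx.symm with h | h | h
      · exact hts h
      · exact (List.pairwise_cons.1 g3).1 q hq' (h ▸ htc)
      · simp only [List.map_cons, List.nodup_cons, List.mem_map, not_exists, not_and] at g4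
        exact g4.1 q hq' h.symm
    have := hl.tail_unique hcf hC.indepA hS hl' (by simp)
    rw [this, hlast'] at hlast
    simp only [Option.some.injEq, Prod.mk.injEq] at hlast
    exact hlast.1.symm

/-- The excess of edges from the tokens outside the cycles to `B` over those to `A`. -/
noncomputable def imbalance (G : SimpleGraph V) (A B S : Finset V) : ℤ :=
  ∑ s ∈ S.filter (fun s => s ∉ A ∧ s ∉ B), (((nbrIn G B s).card : ℤ) - (nbrIn G A s).card)

lemma imbalance_eq_sum {T : Finset V} (h : ∀ v, v ∈ T ↔ v ∈ S ∧ v ∉ A ∧ v ∉ B) :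
    imbalance G A B S = ∑ v ∈ T, (((nbrIn G B v).card : ℤ) - (nbrIn G A v).card) :=
  Finset.sum_congr (by ext v; simp [h]) fun _ _ => rfl

lemma imbalance_swap : imbalance G B A S = -imbalance G A B S := by
  unfold imbalance
  rw [← Finset.sum_neg_distrib]
  refine Finset.sum_congr (by ext; simp; tauto) fun s _ => by ring

lemma imbalance_eq (hcf : ClawFree G) (hC : IsBicycle G A B) :
    imbalance G A B S = (oddTokens G A B S).card - (oddTokens G B A S).card := by
  have e1 : oddTokens G A B S = (S.filter (fun s => s ∉ A ∧ s ∉ B)).filter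
      fun s => (nbrIn G A s).card = 1 ∧ (nbrIn G B s).card = 2 := by
    ext; simp [oddTokens]; tauto
  have e2 : oddTokens G B A S = (S.filter (fun s => s ∉ A ∧ s ∉ B)).filter
      fun s => (nbrIn G B s).card = 1 ∧ (nbrIn G A s).card = 2 := by
    ext; simp [oddTokens]; tauto
  rw [e1, e2, Finset.card_filter, Finset.card_filter]
  push_cast
  rw [← Finset.sum_sub_distrib]
  refine Finset.sum_congr rfl fun s hs => ?_
  obtain ⟨-, hsA, hsB⟩ := Finset.mem_filter.1 hs
  have hA := card_nbrIn_le_two hcf hC.indepA s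
  have hB := card_nbrIn_le_two hcf hC.indepB s
  have h0 : (nbrIn G A s).card = 0 ↔ (nbrIn G B s).card = 0 := by
    rw [← not_iff_not, ← Ne, ← Ne, Finset.card_ne_zero, Finset.card_ne_zero]
    constructor <;> rintro ⟨a, ha⟩ <;> obtain ⟨ha, hsa⟩ := mem_nbrIn.1 ha
    · obtain ⟨b, hb, -, hsb⟩ := hC.exists_common_nbr hcf ha hsB hsa
      exact ⟨b, by simp [hb, hsb]⟩
    · obtain ⟨b, hb, -, hsb⟩ := hC.symm.exists_common_nbr hcf ha hsA hsa
      exact ⟨b, by simp [hb, hsb]⟩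
  generalize (nbrIn G A s).card = m at *
  generalize (nbrIn G B s).card = n at *
  interval_cases m <;> interval_cases n <;> simp_all

lemma even_sum_of_imbalance_eq_zero (hC : IsBicycle G A B) (h0 : imbalance G A B S = 0) :
    Even (∑ s ∈ S, (nbrIn G A s).card + ∑ s ∈ S, (nbrIn G B s).card) := by
  rw [← Finset.sum_add_distrib,
    ← Finset.sum_filter_add_sum_filter_not S (fun s => s ∉ A ∧ s ∉ B)]
  refine Even.add ?_ (Finset.even_sum _ fun s hs => ?_)
  · rw [← Int.even_coe_nat]
    have : ((∑ s ∈ S.filter (fun s => s ∉ A ∧ s ∉ B),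
        ((nbrIn G A s).card + (nbrIn G B s).card) : ℕ) : ℤ) = imbalance G A B S +
        2 * ∑ s ∈ S.filter (fun s => s ∉ A ∧ s ∉ B), ((nbrIn G A s).card : ℤ) := by
      rw [imbalance, Finset.mul_sum, ← Finset.sum_add_distrib]
      push_cast
      exact Finset.sum_congr rfl fun s _ => by ring
    rw [this, h0, zero_add]
    exact even_two_mul _
  · have hs := (Finset.mem_filter.1 hs).2
    have zero : ∀ {X : Finset V}, IsIndep G X → s ∈ X → (nbrIn G X s).card = 0 := by
      intro X hX hsX
      rw [Finset.card_eq_zero, Finset.eq_empty_iff_forall_notMem]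
      intro v hv
      exact hX _ hsX _ (mem_nbrIn.1 hv).1 (mem_nbrIn.1 hv).2
    by_cases hA : s ∈ A
    · rw [zero hC.indepA hA, hC.degA s hA]; decide
    · have hB : s ∈ B := by tauto
      rw [zero hC.indepB hB, hC.degB s hB]; decide

end Counting

section Swaps

variable {V : Type u} [DecidableEq V] {G : SimpleGraph V} {A B S M : Finset V}

/-- The set of first entries of a list of pairs. -/
def fsts (l : List (V × V)) : Finset V := (l.map Prod.fst).toFinset

/-- The set of second entries of a list of pairs. -/
def snds (l : List (V × V)) : Finset V := (l.map Prod.snd).toFinset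

lemma mem_fsts {l : List (V × V)} {v : V} : v ∈ fsts l ↔ ∃ p ∈ l, p.1 = v := by
  simp [fsts]

lemma mem_snds {l : List (V × V)} {v : V} : v ∈ snds l ↔ ∃ p ∈ l, p.2 = v := by
  simp [snds]

/-- A path component of `G` on `M`, listed as matched pairs with equal neighborhoods in `B`.
When `M` is the symmetric difference of independent sets `A` and `S`, exchanging `A` and `S` on
the vertices of the list is a sequence of deformations of `A ∪ B` and of token slides of `S`.
The definition is invariant under reversal of the path. -/
structure IsSwap (G : SimpleGraph V) (M B : Finset V) (l : List (V × V)) : Prop where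
  mem : ∀ p ∈ l, p.1 ∈ M ∧ p.2 ∈ M
  adj : ∀ p ∈ l, G.Adj p.1 p.2
  nbr : ∀ p ∈ l, nbrIn G B p.1 = nbrIn G B p.2
  deg : ∀ p ∈ l, (nbrIn G B p.2).card = 2
  tri : l.Pairwise fun p q => ¬ G.Adj q.1 p.2
  link : l.IsChain fun p q => G.Adj q.2 p.1
  closed : ∀ v ∈ fsts l ∪ snds l, ∀ w ∈ M, G.Adj v w → w ∈ fsts l ∪ snds l
  odd : Odd (∑ s ∈ fsts l, (nbrIn G (snds l) s).card)

lemma fsts_reverse (l : List (V × V)) : fsts (l.map Prod.swap).reverse = snds l := by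
  ext v; simp [fsts, snds]

lemma snds_reverse (l : List (V × V)) : snds (l.map Prod.swap).reverse = fsts l := by
  ext v; simp [fsts, snds]

lemma IsSwap.reverse {l : List (V × V)} (hl : IsSwap G M B l) :
    IsSwap G M B (l.map Prod.swap).reverse where
  mem := by
    intro p hp
    have := hl.mem p.swap (mem_reverse_swap.1 hp)
    exact this.symm
  adj := by
    intro p hp
    have := hl.adj p.swap (mem_reverse_swap.1 hp)
    exact this.symm
  nbr := by
    intro p hp
    have := hl.nbr p.swap (mem_reverse_swap.1 hp)
    exact this.symm
  deg := by
    intro p hp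
    have h1 := hl.nbr p.swap (mem_reverse_swap.1 hp)
    have h2 := hl.deg p.swap (mem_reverse_swap.1 hp)
    rw [← h1] at h2
    exact h2
  tri := by
    rw [List.pairwise_reverse, List.pairwise_map]
    exact hl.tri.imp fun h h' => h h'.symm
  link := by
    rw [List.isChain_reverse, List.isChain_map]
    exact hl.link.imp fun _ _ h => h.symm
  closed := by
    rw [fsts_reverse, snds_reverse, Finset.union_comm]
    exact hl.closed
  odd := by
    rw [fsts_reverse, snds_reverse, ← sum_nbrIn_comm]
    exact hl.odd

/-- The first entries of the swap are tokens, the second entries are vertices of `A`. -/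
def IsOriented (A S : Finset V) (l : List (V × V)) : Prop :=
  ∀ p ∈ l, p.1 ∈ S ∧ p.1 ∉ A ∧ p.2 ∈ A ∧ p.2 ∉ S

lemma IsSwap.oriented {l : List (V × V)} (hl : IsSwap G (symmDiff S A) B l)
    (hA : IsIndep G A) (hS : IsIndep G S) :
    IsOriented A S l ∨ IsOriented A S (l.map Prod.swap).reverse := by
  have side : ∀ {v w}, v ∈ symmDiff S A → w ∈ symmDiff S A → G.Adj v w →
      (v ∈ S ↔ w ∈ A) ∧ (w ∈ S ↔ v ∈ A) := by
    intro v w hv hw hvw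
    have h1 := fun h h' => hA v h w h' hvw
    have h2 := fun h h' => hS v h w h' hvw
    rw [Finset.mem_symmDiff] at hv hw
    tauto
  have hor : (∀ p ∈ l, p.1 ∈ S) ∨ (∀ p ∈ l, p.1 ∉ S) := by
    have hm := hl.mem
    have ha := hl.adj
    have hc := hl.link
    clear hl
    induction l with
    | nil => simp
    | cons p l ih =>
      cases l with
      | nil => simp [em]
      | cons q l =>
        rw [List.isChain_cons_cons] at hc
        have h1 := hm p (by simp)
        have h2 := hm q (by simp)
        have s1 := side h2.2 h1.1 hc.1
        have s2 := side h2.1 h2.2 (ha q (by simp))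
        have h12 : p.1 ∈ S ↔ q.1 ∈ S := by tauto
        rcases ih (fun r hr => hm r (by simp [hr])) (fun r hr => ha r (by simp [hr])) hc.2
          with h | h
        · left
          intro r hr
          rcases List.mem_cons.1 hr with rfl | hr
          · exact h12.2 (h q (by simp))
          · exact h r hr
        · right
          intro r hr
          rcases List.mem_cons.1 hr with rfl | hr
          · exact fun h' => h q (by simp) (h12.1 h')
          · exact h r hr
  refine hor.imp (fun h p hp => ?_) (fun h p hp => ?_)
  · have h1 := hl.mem p hp
    have h2 := side h1.1 h1.2 (hl.adj p hp)
    have h3 := h p hp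
    simp only [Finset.mem_symmDiff] at h1
    tauto
  · have hp' : p.swap ∈ l := mem_reverse_swap.1 hp
    have h1 := hl.mem _ hp'
    have h2 := side h1.1 h1.2 (hl.adj _ hp')
    have h3 := h _ hp'
    simp only [Finset.mem_symmDiff, Prod.fst_swap, Prod.snd_swap] at h1 h2 h3
    tauto

lemma IsOriented.symmDiff_tokens {l : List (V × V)} (ho : IsOriented A S l) :
    symmDiff S (fsts l ∪ snds l) = (S \ fsts l) ∪ snds l := by
  ext v
  have h1 : v ∈ fsts l → v ∈ S := by
    rw [mem_fsts]; rintro ⟨p, hp, rfl⟩; exact (ho p hp).1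
  have h2 : v ∈ snds l → v ∉ S := by
    rw [mem_snds]; rintro ⟨p, hp, rfl⟩; exact (ho p hp).2.2.2
  simp only [Finset.mem_symmDiff, Finset.mem_union, Finset.mem_sdiff]
  tauto

lemma IsOriented.symmDiff_cycle {l : List (V × V)} (ho : IsOriented A S l) :
    symmDiff A (fsts l ∪ snds l) = (A \ snds l) ∪ fsts l := by
  ext v
  have h1 : v ∈ fsts l → v ∉ A := by
    rw [mem_fsts]; rintro ⟨p, hp, rfl⟩; exact (ho p hp).2.1
  have h2 : v ∈ snds l → v ∈ A := by
    rw [mem_snds]; rintro ⟨p, hp, rfl⟩; exact (ho p hp).2.2.1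
  simp only [Finset.mem_symmDiff, Finset.mem_union, Finset.mem_sdiff]
  tauto

lemma fsts_cons (p : V × V) (l : List (V × V)) : fsts (p :: l) = insert p.1 (fsts l) := by
  simp [fsts]

lemma snds_cons (p : V × V) (l : List (V × V)) : snds (p :: l) = insert p.2 (snds l) := by
  simp [snds]

lemma eqvGen_tokenSlide (hA : IsIndep G A) {l : List (V × V)} :
    ∀ {S : Finset V}, IsIndep G S → (∀ p ∈ l, p.1 ∈ S ∧ p.2 ∈ A ∧ p.2 ∉ S ∧ G.Adj p.1 p.2) →
      l.Pairwise (fun p q => ¬ G.Adj q.1 p.2) →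
      (∀ p ∈ l, ∀ t ∈ S, G.Adj p.2 t → t ∈ fsts l) →
      Relation.EqvGen (TokenSlide G) S ((S \ fsts l) ∪ snds l) := by
  induction l with
  | nil =>
    intro S _ _ _ _
    simpa [fsts, snds] using Relation.EqvGen.refl S
  | cons p l ih =>
    intro S hS hp htri hcl
    obtain ⟨hpS, hpA, hpS', hadj⟩ := hp p (by simp)
    rw [List.pairwise_cons] at htri
    have hne : p.1 ≠ p.2 := hadj.ne
    have uniq : ∀ t ∈ S, G.Adj p.2 t → t = p.1 := by
      intro t ht hpt
      obtain ⟨q, hq, rfl⟩ := mem_fsts.1 (hcl p (by simp) t ht hpt)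
      rcases List.mem_cons.1 hq with rfl | hq
      · rfl
      · exact absurd hpt.symm (htri.1 q hq)
    have hS1 : IsIndep G (insert p.2 (S.erase p.1)) := by
      intro u hu v hv huv
      rw [Finset.mem_insert, Finset.mem_erase] at hu hv
      rcases hu with rfl | hu <;> rcases hv with rfl | hv
      · exact G.loopless.irrefl _ huv
      · exact hv.1 (uniq v hv.2 huv)
      · exact hu.1 (uniq u hu.2 huv.symm)
      · exact hS _ hu.2 _ hv.2 huv
    have key := ih hS1 ?_ htri.2 ?_
    · have hset : (insert p.2 (S.erase p.1) \ fsts l) ∪ snds l =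
          (S \ fsts (p :: l)) ∪ snds (p :: l) := by
        have hn : p.2 ∉ fsts l := by
          rw [mem_fsts]; rintro ⟨q, hq, e⟩
          exact hpS' (e ▸ (hp q (by simp [hq])).1)
        rw [fsts_cons, snds_cons]
        ext v
        simp only [Finset.mem_union, Finset.mem_sdiff, Finset.mem_insert, Finset.mem_erase]
        by_cases h : v = p.2
        · subst h; tauto
        · tauto
      rw [hset] at key
      refine .trans _ _ _ (.rel _ _ ⟨hS, hS1, p.1, p.2, hadj, hpS, ?_, ?_, hpS', rfl⟩) key
      · simp [hne]
      · simp
    · intro q hq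
      obtain ⟨hqS, hqA, hqS', hqadj⟩ := hp q (by simp [hq])
      have h1 : q.1 ≠ p.1 := fun e => htri.1 q hq (e ▸ hadj)
      have h2 : q.2 ≠ p.2 := fun e => htri.1 q hq (e ▸ hqadj)
      simp [hqS, hqA, hqS', hqadj, h1, h2]
    · intro q hq t ht hqt
      rw [Finset.mem_insert, Finset.mem_erase] at ht
      rcases ht with rfl | ht
      · exact absurd hqt (hA _ (hp q (by simp [hq])).2.1 _ hpA)
      · have := hcl q (by simp [hq]) t ht.2 hqt
        rw [fsts_cons, Finset.mem_insert] at this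
        tauto

lemma reflTransGen_deform (hA : IsIndep G A) (hS : IsIndep G S) (hAB : Disjoint A B)
    {l : List (V × V)} (hmem : ∀ p ∈ l, p.1 ∈ S ∧ p.1 ∉ A ∧ p.1 ∉ B ∧ p.2 ∈ A ∧ G.Adj p.1 p.2)
    (hnbr : ∀ p ∈ l, nbrIn G B p.1 = nbrIn G B p.2) (hdeg : ∀ p ∈ l, (nbrIn G B p.2).card = 2)
    (htri : l.Pairwise fun p q => ¬ G.Adj q.1 p.2)
    (hcl : ∀ p ∈ l, ∀ a ∈ A, G.Adj p.1 a → a ∈ snds l) :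
    Relation.ReflTransGen (SingleVertexDeform G) (A ∪ B) ((A \ snds l ∪ fsts l) ∪ B) := by
  induction l with
  | nil => simpa [fsts, snds] using Relation.ReflTransGen.refl
  | cons p l ih =>
    rw [List.pairwise_cons] at htri
    obtain ⟨hpS, hpA, hpB, hpA', hadj⟩ := hmem p (by simp)
    refine (ih (fun q hq => hmem q (by simp [hq])) (fun q hq => hnbr q (by simp [hq]))
      (fun q hq => hdeg q (by simp [hq])) htri.2 ?_).tail ?_
    · intro q hq a ha hqa
      have := hcl q (by simp [hq]) a ha hqa
      rw [snds_cons, Finset.mem_insert] at this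
      rcases this with rfl | h
      · exact absurd hqa (htri.1 q hq)
      · exact h
    have hp2s : p.2 ∉ snds l := by
      rw [mem_snds]; rintro ⟨q, hq, e⟩
      exact htri.1 q hq (e ▸ (hmem q (by simp [hq])).2.2.2.2)
    have hp1f : p.1 ∉ fsts l := by
      rw [mem_fsts]; rintro ⟨q, hq, e⟩
      exact htri.1 q hq (e ▸ hadj)
    have hp2B : p.2 ∉ B := Finset.disjoint_left.1 hAB hpA'
    have hfS : ∀ v ∈ fsts l, v ∈ S ∧ v ∉ A ∧ ¬ G.Adj v p.2 := by
      intro v hv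
      obtain ⟨q, hq, rfl⟩ := mem_fsts.1 hv
      exact ⟨(hmem q (by simp [hq])).1, (hmem q (by simp [hq])).2.1, htri.1 q hq⟩
    have hk : ((A \ snds l ∪ fsts l) ∪ B).filter (fun u => G.Adj p.2 u) = nbrIn G B p.2 := by
      ext v
      simp only [Finset.mem_filter, Finset.mem_union, Finset.mem_sdiff, mem_nbrIn]
      refine ⟨?_, fun h => ⟨Or.inr h.1, h.2⟩⟩
      rintro ⟨(h | h) | h, hv⟩
      · exact absurd hv (hA _ hpA' _ h.1)
      · exact absurd hv.symm (hfS v h).2.2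
      · exact ⟨h, hv⟩
    refine ⟨p.1, p.2, ?_, ?_, ?_, ?_, ?_⟩
    · simp [hpA, hpB, hp1f]
    · simp [hpA', hp2s]
    · rw [hk, ← hnbr p (by simp)]
      ext v
      simp only [Finset.mem_filter, Finset.mem_union, Finset.mem_sdiff, mem_nbrIn,
        Finset.mem_insert]
      constructor
      · rintro ⟨(h | h) | h, hv⟩
        · have := hcl p (by simp) v h.1 hv
          rw [snds_cons, Finset.mem_insert] at this
          tauto
        · exact absurd hv (hS _ hpS _ (hfS v h).1)
        · exact Or.inr ⟨h, hv⟩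
      · rintro (rfl | h)
        · exact ⟨Or.inl (Or.inl ⟨hpA', hp2s⟩), hadj⟩
        · exact ⟨Or.inr h.1, h.2⟩
    · rw [hk]; exact hdeg p (by simp)
    · rw [fsts_cons, snds_cons]
      ext v
      have h2 : v ∈ fsts l → v ∉ A := fun h => (hfS v h).2.1
      simp only [Finset.mem_union, Finset.mem_sdiff, Finset.mem_insert, Finset.mem_erase]
      by_cases h : v = p.2
      · subst h
        have : p.2 ≠ p.1 := hadj.ne'
        tauto
      · tauto

end Swaps

section SwapProperties

variable {V : Type u} [DecidableEq V] {G : SimpleGraph V} {A B S : Finset V}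

lemma TokenChain.isSwap (hcf : ClawFree G) (hC : IsBicycle G A B) (hS : IsIndep G S)
    {s c : V} {l : List (V × V)} (hl : TokenChain G A B S ((s, c) :: l))
    (hend : ∀ t ∈ S, G.Adj t c → t = s) :
    IsSwap G (symmDiff S A) B ((s, c) :: l) ∧ IsOriented A S ((s, c) :: l) := by
  obtain ⟨h1, h2, h3, h4⟩ := hl.structure hcf hC.indepA hS
  have hp := hl.pair
  have ho : IsOriented A S ((s, c) :: l) := fun p hpl =>
    ⟨(hp p hpl).1, (hp p hpl).2.1, (hp p hpl).2.2.2.1,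
      fun h => hS _ (hp p hpl).1 _ h (hp p hpl).2.2.2.2.1⟩
  refine ⟨⟨?_, fun p hpl => (hp p hpl).2.2.2.2.1, fun p hpl => (hp p hpl).2.2.2.2.2,
    fun p hpl => hC.degA _ (hp p hpl).2.2.2.1, h3, hl.isChain, ?_, ?_⟩, ho⟩
  · intro p hpl
    obtain ⟨ha, hb, hc, hd⟩ := ho p hpl
    simp [Finset.mem_symmDiff, ha, hb, hc, hd]
  · intro v hv w hw hvw
    rw [Finset.mem_symmDiff] at hw
    rw [Finset.mem_union] at hv ⊢
    rcases hv with hv | hv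
    · obtain ⟨p, hpl, rfl⟩ := mem_fsts.1 hv
      have hwA : w ∈ A := by
        have := fun h => hS _ (hp p hpl).1 w h hvw
        tauto
      exact Or.inr (mem_snds.2 (h1 p hpl w hwA hvw))
    · obtain ⟨p, hpl, rfl⟩ := mem_snds.1 hv
      have hwS : w ∈ S := by
        have := fun h => hC.indepA _ (hp p hpl).2.2.2.1 w h hvw
        tauto
      left
      rw [mem_fsts]
      rcases List.mem_cons.1 hpl with rfl | hpl'
      · exact ⟨(s, c), by simp, (hend w hwS hvw.symm).symm⟩
      · exact h2 p hpl' w hwS hvw.symm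
  · have e : ∀ v ∈ fsts ((s, c) :: l),
        (nbrIn G (snds ((s, c) :: l)) v).card = (nbrIn G A v).card := by
      intro v hv
      congr 1
      ext a
      simp only [mem_nbrIn, mem_snds]
      constructor
      · rintro ⟨⟨q, hq, rfl⟩, hva⟩
        exact ⟨(hp q hq).2.2.2.1, hva⟩
      · rintro ⟨ha, hva⟩
        obtain ⟨p, hpl, rfl⟩ := mem_fsts.1 hv
        exact ⟨h1 p hpl a ha hva, hva⟩
    have hsum : ∑ v ∈ fsts ((s, c) :: l), (nbrIn G A v).card =
        (((s, c) :: l).map fun p => (nbrIn G A p.1).card).sum := by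
      rw [fsts, List.sum_toFinset _ h4, List.map_map]
      rfl
    rw [Finset.sum_congr rfl e, hsum]
    exact hl.odd_sum hcf hC.indepA

section Oriented

variable {l : List (V × V)} (hl : IsSwap G (symmDiff S A) B l) (ho : IsOriented A S l)

include hl ho

lemma IsSwap.nbr_fsts {v a : V} (hv : v ∈ fsts l) (ha : a ∈ A)
    (hS : IsIndep G S) (hva : G.Adj v a) : a ∈ snds l := by
  have hvS : v ∈ S := by
    obtain ⟨p, hp, rfl⟩ := mem_fsts.1 hv
    exact (ho p hp).1
  have haS : a ∉ S := fun h => hS _ hvS _ h hva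
  have := hl.closed v (by simp [hv]) a (by simp [Finset.mem_symmDiff, ha, haS]) hva
  rcases Finset.mem_union.1 this with h | h
  · obtain ⟨p, hp, rfl⟩ := mem_fsts.1 h
    exact absurd (ho p hp).1 haS
  · exact h

lemma IsSwap.nbr_snds {v t : V} (hv : v ∈ snds l) (ht : t ∈ S)
    (hA : IsIndep G A) (hvt : G.Adj v t) : t ∈ fsts l := by
  have hvA : v ∈ A := by
    obtain ⟨p, hp, rfl⟩ := mem_snds.1 hv
    exact (ho p hp).2.2.1
  have htA : t ∉ A := fun h => hA _ hvA _ h hvt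
  have := hl.closed v (by simp [hv]) t (by simp [Finset.mem_symmDiff, ht, htA]) hvt
  rcases Finset.mem_union.1 this with h | h
  · exact h
  · obtain ⟨p, hp, rfl⟩ := mem_snds.1 h
    exact absurd (ho p hp).2.2.1 htA

lemma IsSwap.fsts_notMem (hB : IsIndep G B) {v : V} (hv : v ∈ fsts l) :
    v ∈ S ∧ v ∉ A ∧ v ∉ B ∧ (nbrIn G B v).card = 2 := by
  obtain ⟨p, hp, rfl⟩ := mem_fsts.1 hv
  have h2 : (nbrIn G B p.1).card = 2 := by rw [hl.nbr p hp]; exact hl.deg p hp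
  refine ⟨(ho p hp).1, (ho p hp).2.1, fun h => ?_, h2⟩
  obtain ⟨x, hx⟩ := Finset.card_pos.1 (by rw [h2]; norm_num : 0 < (nbrIn G B p.1).card)
  exact hB _ h _ (mem_nbrIn.1 hx).1 (mem_nbrIn.1 hx).2

omit hl in
lemma IsOriented.snds_mem {v : V} (hv : v ∈ snds l) : v ∈ A ∧ v ∉ S := by
  obtain ⟨p, hp, rfl⟩ := mem_snds.1 hv
  exact (ho p hp).2.2

lemma IsSwap.eqvGen (hA : IsIndep G A) (hS : IsIndep G S) :
    Relation.EqvGen (TokenSlide G) S (symmDiff S (fsts l ∪ snds l)) := by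
  rw [ho.symmDiff_tokens]
  exact eqvGen_tokenSlide hA hS
    (fun p hp => ⟨(ho p hp).1, (ho p hp).2.2.1, (ho p hp).2.2.2, hl.adj p hp⟩) hl.tri
    fun p hp t ht hpt => hl.nbr_snds ho (mem_snds.2 ⟨p, hp, rfl⟩) ht hA hpt

lemma IsSwap.reflTransGen (hC : IsBicycle G A B) (hS : IsIndep G S) :
    Relation.ReflTransGen (SingleVertexDeform G) (A ∪ B) (symmDiff A (fsts l ∪ snds l) ∪ B) := by
  rw [ho.symmDiff_cycle]
  refine reflTransGen_deform hC.indepA hS hC.disj (fun p hp => ?_) hl.nbr hl.deg hl.tri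
    fun p hp a ha hpa => hl.nbr_fsts ho (mem_fsts.2 ⟨p, hp, rfl⟩) ha hS hpa
  exact ⟨(ho p hp).1, (ho p hp).2.1,
    (hl.fsts_notMem ho hC.indepB (mem_fsts.2 ⟨p, hp, rfl⟩)).2.2.1, (ho p hp).2.2.1, hl.adj p hp⟩

lemma IsSwap.indep_cycle (hA : IsIndep G A) (hS : IsIndep G S) :
    IsIndep G (symmDiff A (fsts l ∪ snds l)) := by
  rw [ho.symmDiff_cycle]
  have hf : ∀ v ∈ fsts l, v ∈ S := by
    intro v hv; obtain ⟨p, hp, rfl⟩ := mem_fsts.1 hv; exact (ho p hp).1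
  intro u hu v hv huv
  rw [Finset.mem_union, Finset.mem_sdiff] at hu hv
  rcases hu with hu | hu <;> rcases hv with hv | hv
  · exact hA _ hu.1 _ hv.1 huv
  · exact hu.2 (hl.nbr_fsts ho hv hu.1 hS huv.symm)
  · exact hv.2 (hl.nbr_fsts ho hu hv.1 hS huv)
  · exact hS _ (hf _ hu) _ (hf _ hv) huv

lemma IsSwap.indep_tokens (hA : IsIndep G A) (hS : IsIndep G S) :
    IsIndep G (symmDiff S (fsts l ∪ snds l)) := by
  rw [ho.symmDiff_tokens]
  intro u hu v hv huv
  rw [Finset.mem_union, Finset.mem_sdiff] at hu hv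
  rcases hu with hu | hu <;> rcases hv with hv | hv
  · exact hS _ hu.1 _ hv.1 huv
  · exact hu.2 (hl.nbr_snds ho hv hu.1 hA huv.symm)
  · exact hv.2 (hl.nbr_snds ho hu hv.1 hA huv)
  · exact hA _ (ho.snds_mem hu).1 _ (ho.snds_mem hv).1 huv

lemma IsSwap.disjoint_cycle (hC : IsBicycle G A B) :
    Disjoint (symmDiff A (fsts l ∪ snds l)) B := by
  rw [ho.symmDiff_cycle, Finset.disjoint_left]
  intro v hv
  rw [Finset.mem_union, Finset.mem_sdiff] at hv
  rcases hv with hv | hv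
  · exact hC.notMem_right hv.1
  · exact (hl.fsts_notMem ho hC.indepB hv).2.2.1

omit ho in
lemma IsSwap.card_fsts : (fsts l).card = (snds l).card := by
  have h1 : (l.map Prod.fst).Nodup := by
    rw [List.Nodup, List.pairwise_map]
    refine hl.tri.imp_of_mem fun {p q} hp hq h e => h ?_
    rw [← e]; exact hl.adj p hp
  have h2 : (l.map Prod.snd).Nodup := by
    rw [List.Nodup, List.pairwise_map]
    refine hl.tri.imp_of_mem fun {p q} hp hq h e => h ?_
    rw [e]; exact hl.adj q hq
  rw [fsts, snds, List.toFinset_card_of_nodup h1, List.toFinset_card_of_nodup h2]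
  simp

lemma IsSwap.imbalance_eq (hC : IsBicycle G A B) (hS : IsIndep G S) :
    imbalance G (symmDiff A (fsts l ∪ snds l)) B (symmDiff S (fsts l ∪ snds l)) =
      imbalance G A B S := by
  rw [ho.symmDiff_cycle, ho.symmDiff_tokens]
  have hf := fun v (hv : v ∈ fsts l) => hl.fsts_notMem ho hC.indepB hv
  have hs := fun v (hv : v ∈ snds l) => ho.snds_mem hv
  set R := (S \ fsts l).filter (fun s => s ∉ A ∧ s ∉ B) with hR
  have d1 : Disjoint R (fsts l) := by
    rw [Finset.disjoint_left]; intro v hv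
    simp only [hR, Finset.mem_filter, Finset.mem_sdiff] at hv
    tauto
  have d2 : Disjoint R (snds l) := by
    rw [Finset.disjoint_left]; intro v hv h
    simp only [hR, Finset.mem_filter, Finset.mem_sdiff] at hv
    exact (hs v h).2 hv.1.1
  rw [imbalance_eq_sum (T := R ∪ snds l), imbalance_eq_sum (T := R ∪ fsts l),
    Finset.sum_union d1, Finset.sum_union d2]
  rotate_left
  · intro v
    have := hf v
    simp only [hR, Finset.mem_filter, Finset.mem_union, Finset.mem_sdiff]
    tauto
  · intro v
    have h1 := hf v
    have h2 := hs v
    have h3 := fun h => hC.notMem_right (v := v) h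
    simp only [hR, Finset.mem_filter, Finset.mem_union, Finset.mem_sdiff]
    tauto
  congr 1
  · refine Finset.sum_congr rfl fun s hs' => ?_
    simp only [hR, Finset.mem_filter, Finset.mem_sdiff] at hs'
    congr 3
    ext a
    simp only [mem_nbrIn, Finset.mem_union, Finset.mem_sdiff]
    constructor
    · rintro ⟨h | h, hsa⟩
      · exact ⟨h.1, hsa⟩
      · exact absurd hsa (hS _ hs'.1.1 _ (hf a h).1)
    · rintro ⟨h, hsa⟩
      exact ⟨Or.inl ⟨h, fun h' => hs'.1.2 (hl.nbr_snds ho h' hs'.1.1 hC.indepA hsa.symm)⟩, hsa⟩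
  · have q1 : ∀ v ∈ fsts l, nbrIn G A v = nbrIn G (snds l) v := by
      intro v hv
      ext a
      simp only [mem_nbrIn]
      exact ⟨fun h => ⟨hl.nbr_fsts ho hv h.1 hS h.2, h.2⟩, fun h => ⟨(hs a h.1).1, h.2⟩⟩
    have q2 : ∀ v ∈ snds l, nbrIn G (A \ snds l ∪ fsts l) v = nbrIn G (fsts l) v := by
      intro v hv
      ext a
      simp only [mem_nbrIn, Finset.mem_union, Finset.mem_sdiff]
      constructor
      · rintro ⟨h | h, hva⟩
        · exact absurd hva (hC.indepA _ (hs v hv).1 _ h.1)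
        · exact ⟨h, hva⟩
      · exact fun h => ⟨Or.inr h.1, h.2⟩
    have c1 : ∑ v ∈ fsts l, (((nbrIn G B v).card : ℤ) - (nbrIn G A v).card) =
        2 * (fsts l).card - ((∑ v ∈ fsts l, (nbrIn G (snds l) v).card : ℕ) : ℤ) := by
      rw [Finset.sum_sub_distrib, Finset.sum_congr rfl fun v hv => by rw [(hf v hv).2.2.2],
        Finset.sum_const, Nat.cast_sum]
      congr 1
      · simp [mul_comm]
      · exact Finset.sum_congr rfl fun v hv => by rw [q1 v hv]
    have c2 : ∑ v ∈ snds l, (((nbrIn G B v).card : ℤ) - (nbrIn G (A \ snds l ∪ fsts l) v).card) =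
        2 * (snds l).card - ((∑ v ∈ snds l, (nbrIn G (fsts l) v).card : ℕ) : ℤ) := by
      rw [Finset.sum_sub_distrib, Finset.sum_congr rfl fun v hv => by rw [hC.degA v (hs v hv).1],
        Finset.sum_const, Nat.cast_sum]
      congr 1
      · simp [mul_comm]
      · exact Finset.sum_congr rfl fun v hv => by rw [q2 v hv]
    rw [c2, c1, hl.card_fsts, sum_nbrIn_comm]

end Oriented

lemma isEvenHole_of_deform {L L' : Finset V} (hd : SingleVertexDeform G L L')
    (hL : IsEvenHole G L) : IsEvenHole G L' := by
  obtain ⟨⟨h4, hconn, hdeg⟩, heven⟩ := hL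
  obtain ⟨j, k, hj, hk, hjk, hk2, rfl⟩ := hd
  have hjm : ∀ v, v ∈ L → (G.Adj j v ↔ v = k ∨ G.Adj k v) := by
    intro v hv
    have := Finset.ext_iff.1 hjk v
    simpa [hv, hk] using this
  have hcard : (insert j (L.erase k)).card = L.card := by
    rw [Finset.card_insert_of_notMem (by simp [hj]), Finset.card_erase_of_mem hk]
    omega
  refine ⟨⟨by rwa [hcard], ?_, ?_⟩, by rwa [hcard]⟩
  · let f : G.induce (L : Set V) →g G.induce ((insert j (L.erase k) : Finset V) : Set V) :=
      { toFun := fun v => if h : v.1 = k then ⟨j, by simp⟩ else ⟨v.1, by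
          have := v.2
          simp_all⟩
        map_rel' := by
          rintro ⟨a, ha⟩ ⟨b, hb⟩ hab
          simp only [SimpleGraph.comap_adj, Function.Embedding.subtype_apply] at hab
          have h1 := hjm a ha
          have h2 := hjm b hb
          by_cases hak : a = k <;> by_cases hbk : b = k
          · subst hak; subst hbk; exact absurd hab (G.loopless.irrefl _)
          · subst hak; simp [hbk, h2, hab]
          · subst hbk; simp [hak, G.adj_comm a j, h1, hab.symm]
          · simp [hak, hbk, hab] }
    refine hconn.map f ?_
    rintro ⟨v, hv⟩
    simp only [Finset.coe_insert, Finset.coe_erase, Set.mem_insert_iff, Set.mem_sdiff,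
      Finset.mem_coe, Set.mem_singleton_iff] at hv
    by_cases hvj : v = j
    · subst hvj
      exact ⟨⟨k, hk⟩, by simp [f]⟩
    · have hv' : v ∈ L ∧ v ≠ k := by tauto
      exact ⟨⟨v, hv'.1⟩, by simp [f, hv'.2]⟩
  · intro v hv
    rw [Finset.mem_insert, Finset.mem_erase] at hv
    rcases hv with rfl | ⟨hvk, hv⟩
    · rw [← hk2]
      congr 1
      ext w
      have := hjm w
      have := G.loopless.irrefl v
      have := G.loopless.irrefl k
      simp only [Finset.mem_filter, Finset.mem_insert, Finset.mem_erase]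
      grind
    · rw [← hdeg v hv]
      by_cases hvk' : G.Adj v k
      · have e : (insert j (L.erase k)).filter (fun u => G.Adj v u) =
            insert j ((L.filter fun u => G.Adj v u).erase k) := by
          ext w
          have := (hjm v hv).2 (Or.inr hvk'.symm)
          simp only [Finset.mem_filter, Finset.mem_insert, Finset.mem_erase]
          have := this.symm
          grind
        rw [e, Finset.card_insert_of_notMem (by simp [hj]),
          Finset.card_erase_of_mem (by simp [hk, hvk'])]
        have : 0 < (L.filter fun u => G.Adj v u).card :=
          Finset.card_pos.2 ⟨k, by simp [hk, hvk']⟩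
        omega
      · congr 1
        ext w
        have h1 : ¬ G.Adj v j := by
          rw [G.adj_comm, hjm v hv, G.adj_comm]
          tauto
        simp only [Finset.mem_filter, Finset.mem_insert, Finset.mem_erase]
        grind

lemma isEvenHole_of_reflTransGen {L L' : Finset V}
    (hd : Relation.ReflTransGen (SingleVertexDeform G) L L') (hL : IsEvenHole G L) :
    IsEvenHole G L' := by
  induction hd with
  | refl => exact hL
  | tail _ h ih => exact isEvenHole_of_deform h ih

lemma isBicycle_of_isHole (hL : IsHole G (A ∪ B)) (hA : IsIndep G A) (hB : IsIndep G B)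
    (hAB : Disjoint A B) : IsBicycle G A B := by
  refine ⟨hA, hB, hAB, fun a ha => ?_, fun b hb => ?_⟩
  · rw [← hL.2.2 a (by simp [ha])]
    congr 1
    ext v
    have := fun h => hA a ha v h
    simp only [mem_nbrIn, Finset.mem_filter, Finset.mem_union]
    tauto
  · rw [← hL.2.2 b (by simp [hb])]
    congr 1
    ext v
    have := fun h => hB b hb v h
    simp only [mem_nbrIn, Finset.mem_filter, Finset.mem_union]
    tauto

/-- An induced cycle has only one bipartition, up to the order of the classes. -/
lemma bipartition_unique {A' B' : Finset V} (hL : IsHole G (A ∪ B)) (hA : IsIndep G A)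
    (hB : IsIndep G B) (hAB : Disjoint A B) (hA' : IsIndep G A') (hB' : IsIndep G B')
    (hAB' : Disjoint A' B') (hu : A' ∪ B' = A ∪ B) :
    (A' = A ∧ B' = B) ∨ (A' = B ∧ B' = A) := by
  have mem : ∀ v, (v ∈ A' ∨ v ∈ B') ↔ (v ∈ A ∨ v ∈ B) := fun v => by
    rw [← Finset.mem_union, ← Finset.mem_union, hu]
  have d : ∀ v, v ∈ A → v ∉ B := fun v h => Finset.disjoint_left.1 hAB h
  have d' : ∀ v, v ∈ A' → v ∉ B' := fun v h => Finset.disjoint_left.1 hAB' h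
  have inv : ∀ x y : ((A ∪ B : Finset V) : Set V), (G.induce _).Reachable x y →
      ((x.1 ∈ A ↔ x.1 ∈ A') ↔ (y.1 ∈ A ↔ y.1 ∈ A')) := by
    rintro x y ⟨w⟩
    induction w with
    | nil => exact Iff.rfl
    | @cons x y z h _ ih =>
      rw [← ih]
      simp only [SimpleGraph.comap_adj, Function.Embedding.subtype_apply] at h
      have hx := x.2
      have hy := y.2
      simp only [Finset.coe_union, Set.mem_union, Finset.mem_coe] at hx hy
      have := mem x.1
      have := mem y.1
      have := d x.1
      have := d y.1
      have := fun a b => hA x.1 a y.1 b h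
      have := fun a b => hB x.1 a y.1 b h
      have := fun a b => hA' x.1 a y.1 b h
      have := fun a b => hB' x.1 a y.1 b h
      grind
  obtain ⟨x⟩ := hL.2.1.nonempty
  have all := fun y => inv x y (hL.2.1.preconnected x y)
  by_cases hx : (x.1 ∈ A ↔ x.1 ∈ A')
  · left
    have h1 : ∀ v, v ∈ A ∨ v ∈ B → (v ∈ A ↔ v ∈ A') := fun v hv =>
      (all ⟨v, by simpa using hv⟩).1 hx
    constructor <;> ext v <;> grind
  · right
    have h1 : ∀ v, v ∈ A ∨ v ∈ B → ¬ (v ∈ A ↔ v ∈ A') := fun v hv h =>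
      hx ((all ⟨v, by simpa using hv⟩).2 h)
    constructor <;> ext v <;> grind

end SwapProperties

section Operators

variable {V : Type u} {G : SimpleGraph V} {A B S T : Finset V} {d : ℕ}
  {h : V → Matrix (Fin d) (Fin d) ℂ}

lemma isIndep_of_subset (hT : IsIndep G T) (hST : S ⊆ T) : IsIndep G S :=
  fun u hu v hv => hT u (hST hu) v (hST hv)

lemma pairwise_commute (hcomm : ∀ u v, u ≠ v → ¬ G.Adj u v → h u * h v = h v * h u)
    (hS : IsIndep G S) : (S : Set V).Pairwise fun u v => Commute (h u) (h v) :=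
  fun u hu v hv huv => hcomm u v huv (hS u hu v hv)

@[simp] lemma hProd_empty : hProd h ∅ = 1 := by simp [hProd]

variable [DecidableEq V]

lemma hProd_union (hcomm : ∀ u v, u ≠ v → ¬ G.Adj u v → h u * h v = h v * h u)
    (hST : IsIndep G (S ∪ T)) (hd : Disjoint S T) :
    hProd h (S ∪ T) = hProd h S * hProd h T := by
  have hc := pairwise_commute hcomm hST
  have hS := pairwise_commute hcomm (isIndep_of_subset hST Finset.subset_union_left)
  have hT := pairwise_commute hcomm (isIndep_of_subset hST Finset.subset_union_right)
  rw [hProd, hProd, hProd, dif_pos hc, dif_pos hS, dif_pos hT]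
  exact Finset.noncommProd_union_of_disjoint hd h hc

lemma hProd_insert (hcomm : ∀ u v, u ≠ v → ¬ G.Adj u v → h u * h v = h v * h u)
    {v : V} (hS : IsIndep G (insert v S)) (hv : v ∉ S) :
    hProd h (insert v S) = h v * hProd h S := by
  have hc := pairwise_commute hcomm hS
  have hS := pairwise_commute hcomm (isIndep_of_subset hS (Finset.subset_insert v S))
  rw [hProd, hProd, dif_pos hc, dif_pos hS]
  exact Finset.noncommProd_insert_of_notMem S v h hc hv

lemma mul_hProd (hanti : ∀ u v, G.Adj u v → h u * h v = -(h v * h u))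
    (hcomm : ∀ u v, u ≠ v → ¬ G.Adj u v → h u * h v = h v * h u) (hT : IsIndep G T) (v : V) :
    h v * hProd h T = (-1 : ℤ) ^ (nbrIn G T v).card • (hProd h T * h v) := by
  induction T using Finset.induction_on with
  | empty => simp [nbrIn]
  | insert u T hu ih =>
    rw [hProd_insert hcomm hT hu]
    have ih := ih (isIndep_of_subset hT (Finset.subset_insert u T))
    by_cases hvu : G.Adj v u
    · have e : nbrIn G (insert u T) v = insert u (nbrIn G T v) := by
        ext w; simp only [mem_nbrIn, Finset.mem_insert]; grind
      rw [e, Finset.card_insert_of_notMem (by simp [hu]), ← mul_assoc, hanti v u hvu, neg_mul,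
        mul_assoc, ih, mul_smul_comm, pow_succ, mul_assoc]
      simp
    · have e : nbrIn G (insert u T) v = nbrIn G T v := by
        ext w; simp only [mem_nbrIn, Finset.mem_insert]; grind
      have huv : h v * h u = h u * h v := by
        by_cases hvu' : v = u
        · rw [hvu']
        · exact hcomm v u hvu' hvu
      rw [e, ← mul_assoc, huv, mul_assoc, ih, mul_smul_comm, mul_assoc]

lemma hProd_mul_hProd (hanti : ∀ u v, G.Adj u v → h u * h v = -(h v * h u))
    (hcomm : ∀ u v, u ≠ v → ¬ G.Adj u v → h u * h v = h v * h u) (hS : IsIndep G S)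
    (hT : IsIndep G T) : hProd h S * hProd h T =
      (-1 : ℤ) ^ (∑ s ∈ S, (nbrIn G T s).card) • (hProd h T * hProd h S) := by
  induction S using Finset.induction_on with
  | empty => simp
  | insert u S hu ih =>
    rw [hProd_insert hcomm hS hu, mul_assoc, ih (isIndep_of_subset hS (Finset.subset_insert u S)),
      mul_smul_comm, ← mul_assoc, mul_hProd hanti hcomm hT, smul_mul_assoc, smul_smul, mul_assoc,
      Finset.sum_insert hu, pow_add, mul_comm]

/-- The commutator of `h(A)·h(B)` with `h(S)`. -/
noncomputable def bracket (h : V → Matrix (Fin d) (Fin d) ℂ) (A B S : Finset V) :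
    Matrix (Fin d) (Fin d) ℂ :=
  hProd h A * hProd h B * hProd h S - hProd h S * (hProd h A * hProd h B)

lemma IsBicycle.hProd_comm (hanti : ∀ u v, G.Adj u v → h u * h v = -(h v * h u))
    (hcomm : ∀ u v, u ≠ v → ¬ G.Adj u v → h u * h v = h v * h u) (hC : IsBicycle G A B) :
    hProd h A * hProd h B = hProd h B * hProd h A := by
  have : Even (∑ s ∈ A, (nbrIn G B s).card) :=
    Finset.even_sum _ fun s hs => by rw [hC.degA s hs]; exact even_two
  rw [hProd_mul_hProd hanti hcomm hC.indepA hC.indepB, this.neg_one_pow, one_smul]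

lemma bracket_swap (hanti : ∀ u v, G.Adj u v → h u * h v = -(h v * h u))
    (hcomm : ∀ u v, u ≠ v → ¬ G.Adj u v → h u * h v = h v * h u) (hC : IsBicycle G A B) :
    bracket h B A S = bracket h A B S := by
  rw [bracket, bracket, hC.hProd_comm hanti hcomm]

lemma bracket_eq_zero (hanti : ∀ u v, G.Adj u v → h u * h v = -(h v * h u))
    (hcomm : ∀ u v, u ≠ v → ¬ G.Adj u v → h u * h v = h v * h u) (hC : IsBicycle G A B)
    (hS : IsIndep G S) (h0 : imbalance G A B S = 0) : bracket h A B S = 0 := by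
  have := even_sum_of_imbalance_eq_zero hC h0
  rw [bracket, sub_eq_zero, ← mul_assoc, hProd_mul_hProd hanti hcomm hS hC.indepA,
    smul_mul_assoc, mul_assoc (hProd h A) (hProd h S), hProd_mul_hProd hanti hcomm hS hC.indepB,
    mul_smul_comm, smul_smul, ← pow_add, this.neg_one_pow, one_smul, mul_assoc]

lemma IsSwap.bracket_add (hanti : ∀ u v, G.Adj u v → h u * h v = -(h v * h u))
    (hcomm : ∀ u v, u ≠ v → ¬ G.Adj u v → h u * h v = h v * h u) {l : List (V × V)}
    (hl : IsSwap G (symmDiff S A) B l) (ho : IsOriented A S l) (hC : IsBicycle G A B)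
    (hS : IsIndep G S) :
    bracket h A B S +
      bracket h (symmDiff A (fsts l ∪ snds l)) B (symmDiff S (fsts l ∪ snds l)) = 0 := by
  have hA' := hl.indep_cycle ho hC.indepA hS
  have hS' := hl.indep_tokens ho hC.indepA hS
  rw [ho.symmDiff_cycle] at hA' ⊢
  rw [ho.symmDiff_tokens] at hS' ⊢
  have hf := fun v (hv : v ∈ fsts l) => hl.fsts_notMem ho hC.indepB hv
  have hs := fun v (hv : v ∈ snds l) => ho.snds_mem hv
  have hfS : fsts l ⊆ S := fun v hv => (hf v hv).1
  have hsA : snds l ⊆ A := fun v hv => (hs v hv).1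
  have iP : IsIndep G (fsts l) := isIndep_of_subset hS hfS
  have iQ : IsIndep G (snds l) := isIndep_of_subset hC.indepA hsA
  have dA : Disjoint (A \ snds l) (snds l) := Finset.sdiff_disjoint
  have dS : Disjoint (S \ fsts l) (fsts l) := Finset.sdiff_disjoint
  have dA' : Disjoint (A \ snds l) (fsts l) := by
    rw [Finset.disjoint_right]
    exact fun v hv hv' => (hf v hv).2.1 (Finset.mem_sdiff.1 hv').1
  have dS' : Disjoint (S \ fsts l) (snds l) := by
    rw [Finset.disjoint_right]
    exact fun v hv hv' => (hs v hv).2 (Finset.mem_sdiff.1 hv').1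
  have split : ∀ {X Y : Finset V}, IsIndep G (X ∪ Y) → Disjoint X Y →
      hProd h (X ∪ Y) = hProd h X * hProd h Y ∧ hProd h (X ∪ Y) = hProd h Y * hProd h X :=
    fun hXY hd => ⟨hProd_union hcomm hXY hd, by
      rw [Finset.union_comm] at hXY ⊢; exact hProd_union hcomm hXY hd.symm⟩
  have eA := split (by rw [Finset.sdiff_union_of_subset hsA]; exact hC.indepA) dA
  have eS := split (by rw [Finset.sdiff_union_of_subset hfS]; exact hS) dS
  rw [Finset.sdiff_union_of_subset hsA] at eA
  rw [Finset.sdiff_union_of_subset hfS] at eS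
  have eA' := split hA' dA'
  have eS' := split hS' dS'
  have even_comm : ∀ {X : Finset V}, IsIndep G X → (∀ v ∈ X, (nbrIn G B v).card = 2) →
      hProd h X * hProd h B = hProd h B * hProd h X := by
    intro X hX hdeg
    have : Even (∑ s ∈ X, (nbrIn G B s).card) :=
      Finset.even_sum _ fun s hs => by rw [hdeg s hs]; exact even_two
    rw [hProd_mul_hProd hanti hcomm hX hC.indepB, this.neg_one_pow, one_smul]
  have cP := even_comm iP fun v hv => (hf v hv).2.2.2
  have cQ := even_comm iQ fun v hv => hC.degA v (hs v hv).1
  have cPQ : hProd h (fsts l) * hProd h (snds l) = -(hProd h (snds l) * hProd h (fsts l)) := by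
    rw [hProd_mul_hProd hanti hcomm iP iQ, hl.odd.neg_one_pow, neg_one_smul]
  set P := hProd h (fsts l)
  set Q := hProd h (snds l)
  set A₀ := hProd h (A \ snds l)
  set S₀ := hProd h (S \ fsts l)
  set b := hProd h B
  have left : hProd h A * b * hProd h S = -(hProd h (A \ snds l ∪ fsts l) * b *
      hProd h (S \ fsts l ∪ snds l)) := by
    rw [eA.1, eS.2, eA'.1, eS'.2, mul_assoc A₀, cQ, mul_assoc A₀ P, cP]
    calc A₀ * (b * Q) * (P * S₀) = A₀ * b * (Q * P) * S₀ := by noncomm_ring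
      _ = -(A₀ * b * (P * Q) * S₀) := by rw [cPQ]; noncomm_ring
      _ = _ := by noncomm_ring
  have right : hProd h S * (hProd h A * b) = -(hProd h (S \ fsts l ∪ snds l) *
      (hProd h (A \ snds l ∪ fsts l) * b)) := by
    rw [eA.2, eS.1, eA'.2, eS'.1]
    calc S₀ * P * (Q * A₀ * b) = S₀ * (P * Q) * A₀ * b := by noncomm_ring
      _ = -(S₀ * (Q * P) * A₀ * b) := by rw [cPQ]; noncomm_ring
      _ = _ := by noncomm_ring
  rw [bracket, bracket, left, right]
  abel

end Operators

section Sums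

variable {V : Type u} [DecidableEq V] {G : SimpleGraph V} {A B S : Finset V}

/-- The vertices involved in a chosen swap with respect to `B` inside `M`. -/
noncomputable def swapSet (G : SimpleGraph V) (M B : Finset V) : Finset V :=
  if hx : ∃ l, IsSwap G M B l then fsts hx.choose ∪ snds hx.choose else ∅

lemma exists_swapSet_eq (hx : ∃ l, IsSwap G (symmDiff S A) B l) (hA : IsIndep G A)
    (hS : IsIndep G S) : ∃ l, IsSwap G (symmDiff S A) B l ∧ IsOriented A S l ∧
      swapSet G (symmDiff S A) B = fsts l ∪ snds l := by
  rw [swapSet, dif_pos hx]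
  rcases hx.choose_spec.oriented hA hS with ho | ho
  · exact ⟨_, hx.choose_spec, ho, rfl⟩
  · exact ⟨_, hx.choose_spec.reverse, ho, by rw [fsts_reverse, snds_reverse, Finset.union_comm]⟩

variable [Fintype V]

lemma exists_isSwap (hcf : ClawFree G) (hC : IsBicycle G A B) (hS : IsIndep G S)
    (hpos : 0 < imbalance G A B S) : ∃ l, IsSwap G (symmDiff S A) B l := by
  rw [imbalance_eq hcf hC] at hpos
  obtain ⟨s, c, l, hl, hend⟩ := exists_terminal_chain hcf hC hS (by omega)
  exact ⟨_, (hl.isSwap hcf hC hS hend).1⟩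

lemma isIndep_of_mem {k : ℕ} {μ : Finset (Finset V)} (hμ : IsTokenClass G k μ)
    (hS : S ∈ μ) : IsIndep G S := by
  obtain ⟨S₀, h0, -, hm⟩ := hμ
  have key : ∀ S T, Relation.EqvGen (TokenSlide G) S T → (IsIndep G S ↔ IsIndep G T) := by
    intro S T hST
    induction hST with
    | rel _ _ h => exact iff_of_true h.1 h.2.1
    | refl => exact Iff.rfl
    | symm _ _ _ ih => exact ih.symm
    | trans _ _ _ _ _ ih₁ ih₂ => exact ih₁.trans ih₂
  exact (key _ _ ((hm S).1 hS)).1 h0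

/-- The ordered bipartitions of the holes in the deformation closure of `C₀`. -/
noncomputable def bipartitions (G : SimpleGraph V) (C₀ : Finset V) :
    Finset (Finset V × Finset V) :=
  Finset.univ.filter fun p => p.1 ∪ p.2 ∈ deformClosure G C₀ ∧ Disjoint p.1 p.2 ∧
    IsIndep G p.1 ∧ IsIndep G p.2

lemma mem_bipartitions {C₀ : Finset V} {p : Finset V × Finset V} :
    p ∈ bipartitions G C₀ ↔ (IsEvenHole G (p.1 ∪ p.2) ∧
      Relation.ReflTransGen (SingleVertexDeform G) C₀ (p.1 ∪ p.2)) ∧ Disjoint p.1 p.2 ∧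
        IsIndep G p.1 ∧ IsIndep G p.2 := by
  simp [bipartitions, deformClosure]

lemma swap_mem_bipartitions {C₀ : Finset V} {p : Finset V × Finset V}
    (hp : p ∈ bipartitions G C₀) : p.swap ∈ bipartitions G C₀ := by
  rw [mem_bipartitions] at hp ⊢
  obtain ⟨h1, h2, h3, h4⟩ := hp
  exact ⟨by rwa [Prod.fst_swap, Prod.snd_swap, Finset.union_comm], h2.symm, h4, h3⟩

lemma isBicycle_of_mem {C₀ : Finset V} {p : Finset V × Finset V}
    (hp : p ∈ bipartitions G C₀) : IsBicycle G p.1 p.2 := by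
  rw [mem_bipartitions] at hp
  exact isBicycle_of_isHole hp.1.1.1 hp.2.2.1 hp.2.2.2 hp.2.1

variable {d : ℕ} {h : V → Matrix (Fin d) (Fin d) ℂ}

lemma sum_bipartitions (hanti : ∀ u v, G.Adj u v → h u * h v = -(h v * h u))
    (hcomm : ∀ u v, u ≠ v → ¬ G.Adj u v → h u * h v = h v * h u) (C₀ : Finset V) :
    ∑ p ∈ bipartitions G C₀, hProd h p.1 * hProd h p.2 = 2 • cycleSymm G h C₀ := by
  have maps : ∀ p ∈ bipartitions G C₀, p.1 ∪ p.2 ∈ deformClosure G C₀ := fun p hp =>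
    (Finset.mem_filter.1 hp).2.1
  rw [← Finset.sum_fiberwise_of_maps_to maps, cycleSymm, Finset.smul_sum]
  refine Finset.sum_congr rfl fun C hC => ?_
  rw [holeOp]
  split_ifs with hx
  · obtain ⟨hu, hd, hA, hB⟩ := hx.choose_spec
    set q := hx.choose
    have hq : q ∈ bipartitions G C₀ := by
      rw [bipartitions, Finset.mem_filter, hu]
      exact ⟨Finset.mem_univ _, hC, hd, hA, hB⟩
    have hbi := isBicycle_of_mem hq
    have hole : IsHole G (q.1 ∪ q.2) := (mem_bipartitions.1 hq).1.1.1
    have hne : q ≠ q.swap := by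
      intro e
      have e1 : q.1 = q.2 := congrArg Prod.fst e
      rw [← e1, disjoint_self] at hd
      have h4 := hole.1
      rw [← e1, hd] at h4
      simp at h4
    have e : (bipartitions G C₀).filter (fun p => p.1 ∪ p.2 = C) = {q, q.swap} := by
      ext p
      rw [Finset.mem_filter, Finset.mem_insert, Finset.mem_singleton]
      constructor
      · rintro ⟨hp, hpC⟩
        obtain ⟨-, h2, h3, h4⟩ := mem_bipartitions.1 hp
        rcases bipartition_unique hole hA hB hd h3 h4 h2 (by rw [hpC, hu]) with ⟨h5, h6⟩ | ⟨h5, h6⟩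
        · exact Or.inl (Prod.ext h5 h6)
        · exact Or.inr (Prod.ext h5 h6)
      · rintro (rfl | rfl)
        · exact ⟨hq, hu⟩
        · exact ⟨swap_mem_bipartitions hq, by rw [← hu]; exact Finset.union_comm _ _⟩
    rw [e, Finset.sum_pair hne, two_smul, Prod.fst_swap, Prod.snd_swap,
      hbi.hProd_comm hanti hcomm]
  · rw [smul_zero]
    refine Finset.sum_eq_zero fun p hp => absurd ⟨p, ?_⟩ hx
    rw [Finset.mem_filter] at hp
    exact ⟨hp.2, (Finset.mem_filter.1 hp.1).2.2⟩

lemma sum_bracket_pos (hcf : ClawFree G) (hanti : ∀ u v, G.Adj u v → h u * h v = -(h v * h u))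
    (hcomm : ∀ u v, u ≠ v → ¬ G.Adj u v → h u * h v = h v * h u) (C₀ : Finset V)
    {k : ℕ} {μ : Finset (Finset V)} (hμ : IsTokenClass G k μ) :
    ∑ x ∈ (bipartitions G C₀ ×ˢ μ).filter (fun x => 0 < imbalance G x.1.1 x.1.2 x.2),
      bracket h x.1.1 x.1.2 x.2 = 0 := by
  have spec : ∀ x ∈ (bipartitions G C₀ ×ˢ μ).filter
      (fun x => 0 < imbalance G x.1.1 x.1.2 x.2),
      (IsBicycle G x.1.1 x.1.2 ∧ IsIndep G x.2) ∧
      ∃ l, IsSwap G (symmDiff x.2 x.1.1) x.1.2 l ∧ IsOriented x.1.1 x.2 l ∧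
        swapSet G (symmDiff x.2 x.1.1) x.1.2 = fsts l ∪ snds l := by
    intro x hx
    rw [Finset.mem_filter, Finset.mem_product] at hx
    have hC := isBicycle_of_mem hx.1.1
    have hS := isIndep_of_mem hμ hx.1.2
    exact ⟨⟨hC, hS⟩, exists_swapSet_eq (exists_isSwap hcf hC hS hx.2) hC.indepA hS⟩
  refine Finset.sum_involution (fun x _ =>
    ((symmDiff x.1.1 (swapSet G (symmDiff x.2 x.1.1) x.1.2), x.1.2),
      symmDiff x.2 (swapSet G (symmDiff x.2 x.1.1) x.1.2))) ?_ ?_ ?_ ?_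
  · intro x hx
    obtain ⟨⟨hC, hS⟩, l, hl, ho, e⟩ := spec x hx
    simp only [e]
    exact hl.bracket_add hanti hcomm ho hC hS
  · intro x hx _ hfix
    obtain ⟨-, l, hl, -, e⟩ := spec x hx
    have h1 := congrArg Prod.snd hfix
    simp only [symmDiff_eq_left, e] at h1
    have h2 : fsts l = ∅ := (Finset.union_eq_empty.1 h1).1
    have h3 := hl.odd
    simp [h2] at h3
  · intro x hx
    obtain ⟨⟨hC, hS⟩, l, hl, ho, e⟩ := spec x hx
    rw [Finset.mem_filter, Finset.mem_product] at hx ⊢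
    obtain ⟨⟨hp, hm⟩, hpos⟩ := hx
    simp only [e]
    have hr := hl.reflTransGen ho hC hS
    obtain ⟨⟨h1, h2⟩, -⟩ := mem_bipartitions.1 hp
    refine ⟨⟨mem_bipartitions.2 ⟨⟨isEvenHole_of_reflTransGen hr h1, h2.trans hr⟩,
      hl.disjoint_cycle ho hC, hl.indep_cycle ho hC.indepA hS, hC.indepB⟩, ?_⟩, ?_⟩
    · obtain ⟨S₀, -, -, hμ⟩ := hμ
      exact (hμ _).2 (((hμ _).1 hm).trans _ _ _ (hl.eqvGen ho hC.indepA hS))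
    · rwa [hl.imbalance_eq ho hC hS]
  · intro x hx
    have e : ∀ X Y Z : Finset V, symmDiff (symmDiff X Z) (symmDiff Y Z) = symmDiff X Y := by
      intro X Y Z
      rw [symmDiff_symmDiff_symmDiff_comm, symmDiff_self, symmDiff_bot]
    simp only [e, symmDiff_symmDiff_cancel_right]

lemma sum_bracket (hcf : ClawFree G) (hanti : ∀ u v, G.Adj u v → h u * h v = -(h v * h u))
    (hcomm : ∀ u v, u ≠ v → ¬ G.Adj u v → h u * h v = h v * h u) (C₀ : Finset V)
    {k : ℕ} {μ : Finset (Finset V)} (hμ : IsTokenClass G k μ) :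
    ∑ x ∈ bipartitions G C₀ ×ˢ μ, bracket h x.1.1 x.1.2 x.2 = 0 := by
  have hpos := sum_bracket_pos hcf hanti hcomm C₀ hμ
  rw [← Finset.sum_filter_add_sum_filter_not _ (fun x => 0 < imbalance G x.1.1 x.1.2 x.2), hpos,
    zero_add,
    ← Finset.sum_filter_add_sum_filter_not _ (fun x => imbalance G x.1.1 x.1.2 x.2 < 0)]
  have hzero : ∑ x ∈ ((bipartitions G C₀ ×ˢ μ).filter
      (fun x => ¬ 0 < imbalance G x.1.1 x.1.2 x.2)).filter
      (fun x => ¬ imbalance G x.1.1 x.1.2 x.2 < 0), bracket h x.1.1 x.1.2 x.2 = 0 := by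
    refine Finset.sum_eq_zero fun x hx => ?_
    simp only [Finset.mem_filter, Finset.mem_product] at hx
    exact bracket_eq_zero hanti hcomm (isBicycle_of_mem hx.1.1.1)
      (isIndep_of_mem hμ hx.1.1.2) (by omega)
  rw [hzero, add_zero, ← hpos]
  refine Finset.sum_nbij' (fun x => (x.1.swap, x.2)) (fun x => (x.1.swap, x.2)) ?_ ?_
    (fun _ _ => by simp) (fun _ _ => by simp) ?_
  · intro x hx
    simp only [Finset.mem_filter, Finset.mem_product, Prod.fst_swap, Prod.snd_swap] at hx ⊢
    refine ⟨⟨swap_mem_bipartitions hx.1.1.1, hx.1.1.2⟩, ?_⟩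
    rw [imbalance_swap]
    omega
  · intro x hx
    simp only [Finset.mem_filter, Finset.mem_product, Prod.fst_swap, Prod.snd_swap] at hx ⊢
    rw [imbalance_swap]
    exact ⟨⟨⟨swap_mem_bipartitions hx.1.1, hx.1.2⟩, by omega⟩, by omega⟩
  · intro x hx
    simp only [Finset.mem_filter, Finset.mem_product] at hx
    exact (bracket_swap hanti hcomm (isBicycle_of_mem hx.1.1.1)).symm

end Sums

end ClawFreeSymmetry

/-- Theorem 1(ii): for a claw-free graph with an operator realization, each generalized cycle
symmetry commutes with each token-sliding charge. -/
theorem cycleSymm_commutes_tokenCharge {V : Type u} [Fintype V] [DecidableEq V]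
    (G : SimpleGraph V) (hcf : ClawFree G) (d : ℕ) (hd : 0 < d)
    (h : V → Matrix (Fin d) (Fin d) ℂ) (b : V → ℝ) (hb : ∀ v, b v ≠ 0)
    (hsq : ∀ v, h v * h v = ((b v : ℂ)) ^ 2 • (1 : Matrix (Fin d) (Fin d) ℂ))
    (hanti : ∀ u v, G.Adj u v → h u * h v = -(h v * h u))
    (hcomm : ∀ u v, u ≠ v → ¬ G.Adj u v → h u * h v = h v * h u)
    (C₀ : Finset V) (hC₀ : IsEvenHole G C₀)
    (k : ℕ) (μ : Finset (Finset V)) (hμ : IsTokenClass G k μ) :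
    cycleSymm G h C₀ * tokenCharge h μ = tokenCharge h μ * cycleSymm G h C₀ := by
  have h0 := ClawFreeSymmetry.sum_bracket hcf hanti hcomm C₀ hμ
  simp only [ClawFreeSymmetry.bracket] at h0
  rw [Finset.sum_sub_distrib, Finset.sum_product, Finset.sum_product_right] at h0
  simp only [← Finset.mul_sum] at h0
  rw [← Finset.sum_mul] at h0
  simp only [ClawFreeSymmetry.sum_bipartitions hanti hcomm C₀] at h0
  rw [← Finset.sum_mul, smul_mul_assoc, mul_smul_comm, ← smul_sub, ← Nat.cast_smul_eq_nsmul ℂ] at h0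
  exact sub_eq_zero.1 ((smul_eq_zero.1 h0).resolve_left (by norm_num))
end

section
/- Let G = (V, E) be a finite simple claw-free graph with an operator realization. Then for any two even holes C₀ and C₀' of G, the generalized cycle symmetries commute: J_{⟨C₀⟩}(G)·J_{⟨C₀'⟩}(G) = J_{⟨C₀'⟩}(G)·J_{⟨C₀⟩}(G). (Theorem 1(iii).) -/
open scoped Classical

universe u

section Holes

variable {V : Type u} {G : SimpleGraph V}

/-- `j ∉ B` has the same neighbors in `B` as `k ∈ B`, apart from `k` itself. -/
def Twin (G : SimpleGraph V) (B : Finset V) (j k : V) : Prop :=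
  j ∉ B ∧ k ∈ B ∧ ∀ y ∈ B, G.Adj j y ↔ y = k ∨ G.Adj k y

lemma Twin.ne {B : Finset V} {j k : V} (ht : Twin G B j k) : j ≠ k := by
  rintro rfl
  exact ht.1 ht.2.1

lemma Twin.adj {B : Finset V} {j k : V} (ht : Twin G B j k) : G.Adj j k :=
  (ht.2.2 k ht.2.1).2 (Or.inl rfl)

variable [DecidableEq V]

/-- A nonempty subset of a hole that is closed under adjacency is the whole hole. -/
lemma IsHole.eq_of_closed {B S : Finset V} (hB : IsHole G B) (hS : S ⊆ B) (hne : S.Nonempty)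
    (hcl : ∀ s ∈ S, ∀ b ∈ B, G.Adj s b → b ∈ S) : S = B := by
  refine Finset.Subset.antisymm hS fun b hb => ?_
  obtain ⟨s, hs⟩ := hne
  obtain ⟨w⟩ := hB.2.1.preconnected ⟨s, hS hs⟩ ⟨b, hb⟩
  have key : ∀ (x y : (B : Set V)), (G.induce (B : Set V)).Walk x y → x.1 ∈ S → y.1 ∈ S := by
    intro x y w
    induction w with
    | nil => exact id
    | cons hadj _ ih => exact fun hx => ih (hcl _ hx _ (Subtype.prop _) hadj)
  exact key _ _ w hs

lemma IsHole.eq_or_eq {B : Finset V} (hB : IsHole G B) {x y z w : V} (hx : x ∈ B) (hy : y ∈ B)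
    (hz : z ∈ B) (hw : w ∈ B) (hyz : y ≠ z) (hxy : G.Adj x y) (hxz : G.Adj x z)
    (hxw : G.Adj x w) : w = y ∨ w = z := by
  by_contra! hcon
  have hsub : ({w, y, z} : Finset V) ⊆ B.filter fun u => G.Adj x u := by
    intro t ht
    simp only [Finset.mem_insert, Finset.mem_singleton] at ht
    rcases ht with rfl | rfl | rfl <;> simp [*]
  have h3 : ({w, y, z} : Finset V).card = 3 := by
    rw [Finset.card_eq_three]
    exact ⟨w, y, z, hcon.1, hcon.2, hyz, rfl⟩
  have := Finset.card_le_card hsub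
  rw [hB.2.2 x hx] at this
  omega

lemma IsHole.not_triangle {B : Finset V} (hB : IsHole G B) {x y z : V} (hx : x ∈ B) (hy : y ∈ B)
    (hz : z ∈ B) (hxy : G.Adj x y) (hyz : G.Adj y z) (hxz : G.Adj x z) : False := by
  have hS : ({x, y, z} : Finset V) = B := by
    refine hB.eq_of_closed ?_ ⟨x, by simp⟩ ?_
    · intro t ht
      simp only [Finset.mem_insert, Finset.mem_singleton] at ht
      rcases ht with rfl | rfl | rfl <;> assumption
    · intro s hs b hb hsb
      simp only [Finset.mem_insert, Finset.mem_singleton] at hs ⊢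
      rcases hs with rfl | rfl | rfl
      · have := hB.eq_or_eq hx hy hz hb hyz.ne hxy hxz hsb
        tauto
      · have := hB.eq_or_eq hy hx hz hb hxz.ne hxy.symm hyz hsb
        tauto
      · have := hB.eq_or_eq hz hx hy hb hxy.ne hxz.symm hyz.symm hsb
        tauto
  have := hB.1
  rw [← hS] at this
  have h3 : ({x, y, z} : Finset V).card ≤ 3 := Finset.card_le_three
  omega

lemma Twin.symm {B : Finset V} {j k : V} (ht : Twin G B j k) :
    Twin G (insert j (B.erase k)) k j := by
  refine ⟨by simp [ht.ne.symm], by simp, fun y hy => ?_⟩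
  rcases Finset.mem_insert.1 hy with rfl | hy
  · simp [ht.adj.symm]
  · have hyB := Finset.mem_of_mem_erase hy
    have hyk := Finset.ne_of_mem_erase hy
    have hyj : y ≠ j := fun h => ht.1 (h ▸ hyB)
    simp [ht.2.2 y hyB, hyk, hyj]

lemma Twin.swap_back {B : Finset V} {j k : V} (ht : Twin G B j k) :
    insert k ((insert j (B.erase k)).erase j) = B := by
  rw [Finset.erase_insert (fun h => ht.1 (Finset.mem_of_mem_erase h)), Finset.insert_erase ht.2.1]

lemma Twin.card_swap {B : Finset V} {j k : V} (ht : Twin G B j k) :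
    (insert j (B.erase k)).card = B.card := by
  rw [Finset.card_insert_of_notMem (fun h => ht.1 (Finset.mem_of_mem_erase h)),
    Finset.card_erase_add_one ht.2.1]

lemma Twin.filter_eq {B : Finset V} {j k : V} (ht : Twin G B j k) :
    (B.filter fun u => G.Adj j u) = insert k (B.filter fun u => G.Adj k u) := by
  ext y
  simp only [Finset.mem_filter, Finset.mem_insert]
  constructor
  · rintro ⟨hy, hjy⟩
    exact ((ht.2.2 y hy).1 hjy).imp id fun h => ⟨hy, h⟩
  · rintro (rfl | ⟨hy, hky⟩)
    · exact ⟨ht.2.1, ht.adj⟩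
    · exact ⟨hy, (ht.2.2 y hy).2 (Or.inr hky)⟩

lemma Twin.deform {B : Finset V} {j k : V} (ht : Twin G B j k) (hB : IsHole G B) :
    SingleVertexDeform G B (insert j (B.erase k)) :=
  ⟨j, k, ht.1, ht.2.1, ht.filter_eq, hB.2.2 k ht.2.1, rfl⟩

lemma Twin.adj_swap_iff {B : Finset V} {j k x y : V} (ht : Twin G B j k) (hx : x ∈ B)
    (hy : y ∈ B) : G.Adj (Equiv.swap j k x) (Equiv.swap j k y) ↔ G.Adj x y := by
  have hxj : x ≠ j := fun h => ht.1 (h ▸ hx)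
  have hyj : y ≠ j := fun h => ht.1 (h ▸ hy)
  by_cases hxk : x = k <;> by_cases hyk : y = k
  · subst hxk; subst hyk; simp
  · subst hxk
    rw [Equiv.swap_apply_right, Equiv.swap_apply_of_ne_of_ne hyj hyk, ht.2.2 y hy]
    simp [hyk]
  · subst hyk
    rw [Equiv.swap_apply_right, Equiv.swap_apply_of_ne_of_ne hxj hxk, G.adj_comm, ht.2.2 x hx,
      G.adj_comm x]
    simp [hxk]
  · rw [Equiv.swap_apply_of_ne_of_ne hyj hyk, Equiv.swap_apply_of_ne_of_ne hxj hxk]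

lemma Twin.image_swap {B : Finset V} {j k : V} (ht : Twin G B j k) :
    B.image (Equiv.swap j k) = insert j (B.erase k) := by
  ext y
  simp only [Finset.mem_image, Finset.mem_insert, Finset.mem_erase]
  constructor
  · rintro ⟨x, hx, rfl⟩
    have hxj : x ≠ j := fun h => ht.1 (h ▸ hx)
    by_cases hxk : x = k
    · subst hxk; simp
    · rw [Equiv.swap_apply_of_ne_of_ne hxj hxk]; exact Or.inr ⟨hxk, hx⟩
  · rintro (rfl | ⟨hyk, hy⟩)
    · exact ⟨k, ht.2.1, Equiv.swap_apply_right _ _⟩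
    · exact ⟨y, hy, Equiv.swap_apply_of_ne_of_ne (fun h => ht.1 (h ▸ hy)) hyk⟩

lemma Twin.isHole {B : Finset V} {j k : V} (ht : Twin G B j k) (hB : IsHole G B) :
    IsHole G (insert j (B.erase k)) := by
  refine ⟨ht.card_swap ▸ hB.1, ?_, ?_⟩
  · have him := ht.image_swap
    have hmem : ∀ x ∈ B, Equiv.swap j k x ∈ insert j (B.erase k) := fun x hx =>
      him ▸ Finset.mem_image_of_mem _ hx
    let f : G.induce (B : Set V) →g G.induce ((insert j (B.erase k) : Finset V) : Set V) :=
      { toFun := fun x => ⟨Equiv.swap j k x.1, hmem x.1 x.2⟩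
        map_rel' := fun {x y} hxy => (ht.adj_swap_iff x.2 y.2).2 hxy }
    refine hB.2.1.map f ?_
    rintro ⟨y, hy⟩
    have hy' : y ∈ B.image (Equiv.swap j k) := him ▸ hy
    obtain ⟨x, hx, rfl⟩ := Finset.mem_image.1 hy'
    exact ⟨⟨x, hx⟩, rfl⟩
  · rw [← ht.image_swap]
    intro v hv
    obtain ⟨x, hx, rfl⟩ := Finset.mem_image.1 hv
    rw [← hB.2.2 x hx, Finset.filter_image, Finset.card_image_of_injective _ (Equiv.injective _)]
    congr 1
    exact Finset.filter_congr fun y hy => ht.adj_swap_iff hx hy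

lemma Twin.isEvenHole {B : Finset V} {j k : V} (ht : Twin G B j k) (hB : IsEvenHole G B) :
    IsEvenHole G (insert j (B.erase k)) :=
  ⟨ht.isHole hB.1, ht.card_swap ▸ hB.2⟩

lemma Twin.unique {B : Finset V} {j k k' : V} (hB : IsHole G B) (ht : Twin G B j k)
    (ht' : Twin G B j k') : k = k' := by
  by_contra hne
  have hk := hB.2.2 k ht.2.1
  have hkk' : G.Adj k k' := ((ht.2.2 k' ht'.2.1).1 ht'.adj).resolve_left (Ne.symm hne)
  obtain ⟨v, hv, hvk'⟩ := 
    Finset.exists_mem_ne (s := B.filter fun u => G.Adj k u) (by rw [hk]; norm_num) k'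
  rw [Finset.mem_filter] at hv
  have hjv : G.Adj j v := (ht.2.2 v hv.1).2 (Or.inr hv.2)
  have hk'v := ((ht'.2.2 v hv.1).1 hjv).resolve_left hvk'
  exact hB.not_triangle ht.2.1 ht'.2.1 hv.1 hkk' hk'v hv.2

/-- In a claw-free graph, a vertex with an odd number of neighbors in an even hole deforms it. -/
lemma IsEvenHole.exists_twin (hcf : ClawFree G) {B : Finset V} (hB : IsEvenHole G B) {j : V}
    (hodd : Odd (B.filter fun u => G.Adj j u).card) : ∃ k, Twin G B j k := by
  have hj : j ∉ B := fun h => by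
    rw [hB.1.2.2 j h] at hodd
    exact absurd hodd (by decide)
  set X := B.filter fun u => G.Adj j u with hX
  have memX : ∀ x, x ∈ X ↔ x ∈ B ∧ G.Adj j x := fun x => by rw [hX, Finset.mem_filter]
  have hsub : ∀ x, (X.filter fun u => G.Adj x u) ⊆ B.filter fun u => G.Adj x u := fun x =>
    Finset.filter_subset_filter _ (Finset.filter_subset _ _)
  -- every neighbor of `j` in `B` has a neighbor in `X`
  have hpos : ∀ x ∈ X, 1 ≤ (X.filter fun u => G.Adj x u).card := by
    intro x hx
    by_contra hlt
    have hempty : (X.filter fun u => G.Adj x u) = ∅ := Finset.card_eq_zero.1 (by omega)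
    obtain ⟨hxB, hjx⟩ := (memX x).1 hx
    obtain ⟨a, c, hac, hxac⟩ := Finset.card_eq_two.1 (hB.1.2.2 x hxB)
    have ha : a ∈ B ∧ G.Adj x a := Finset.mem_filter.1 (hxac ▸ by simp)
    have hc : c ∈ B ∧ G.Adj x c := Finset.mem_filter.1 (hxac ▸ by simp)
    have hnot : ∀ y ∈ B, G.Adj x y → ¬ G.Adj j y := fun y hy hxy hjy => by
      have : y ∈ X.filter fun u => G.Adj x u := Finset.mem_filter.2 ⟨(memX y).2 ⟨hy, hjy⟩, hxy⟩
      rw [hempty] at this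
      simp at this
    exact hcf ⟨x, j, a, c, fun h => hj (h ▸ ha.1), fun h => hj (h ▸ hc.1), hac, hjx.symm, ha.2,
      hc.2, hnot a ha.1 ha.2, hnot c hc.1 hc.2,
      fun h => hB.1.not_triangle hxB ha.1 hc.1 ha.2 h hc.2⟩
  -- some neighbor of `j` has both its neighbors in `X`, by the handshake lemma
  obtain ⟨k, hkX, hk2⟩ : ∃ k ∈ X, (X.filter fun u => G.Adj k u).card = 2 := by
    by_contra! hcon
    have hone : ∀ x ∈ X, (X.filter fun u => G.Adj x u).card = 1 := by
      intro x hx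
      have h1 := hpos x hx
      have h2 := Finset.card_le_card (hsub x)
      rw [hB.1.2.2 x ((memX x).1 hx).1] at h2
      have h3 := hcon x hx
      omega
    have hchoose : ∀ x ∈ X, ∃ y, (X.filter fun u => G.Adj x u) = {y} := fun x hx =>
      Finset.card_eq_one.1 (hone x hx)
    choose! f hf using hchoose
    have hfm : ∀ x ∈ X, f x ∈ X ∧ G.Adj x (f x) := fun x hx =>
      Finset.mem_filter.1 (hf x hx ▸ Finset.mem_singleton_self _)
    have heven : Even X.card := by
      rw [Nat.even_iff]
      have hz : ∑ x ∈ X, (1 : ZMod 2) = 0 :=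
        Finset.sum_involution (fun x _ => f x) (fun _ _ => by decide)
          (fun x hx _ => (hfm x hx).2.ne') (fun x hx => (hfm x hx).1) (fun x hx => by
            have h1 : x ∈ X.filter fun u => G.Adj (f x) u :=
              Finset.mem_filter.2 ⟨hx, (hfm x hx).2.symm⟩
            rw [hf _ (hfm x hx).1, Finset.mem_singleton] at h1
            exact h1.symm)
      rw [Finset.sum_const, nsmul_eq_mul, mul_one, ZMod.natCast_eq_zero_iff] at hz
      omega
    exact (Nat.not_even_iff_odd.2 hodd) heven
  obtain ⟨hkB, hjk⟩ := (memX k).1 hkX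
  have hkeq : (X.filter fun u => G.Adj k u) = B.filter fun u => G.Adj k u :=
    Finset.eq_of_subset_of_card_le (hsub k) (by rw [hk2, hB.1.2.2 k hkB])
  obtain ⟨a, c, hac, hkac⟩ := Finset.card_eq_two.1 hk2
  have ha : a ∈ X ∧ G.Adj k a := Finset.mem_filter.1 (hkac ▸ by simp)
  have hc : c ∈ X ∧ G.Adj k c := Finset.mem_filter.1 (hkac ▸ by simp)
  have haB := (memX a).1 ha.1
  have hcB := (memX c).1 hc.1
  have hac' : ¬ G.Adj a c := fun h => hB.1.not_triangle hkB haB.1 hcB.1 ha.2 h hc.2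
  have hknot : ∀ y ∈ B, G.Adj k y → y = a ∨ y = c := fun y hy hky =>
    hB.1.eq_or_eq hkB haB.1 hcB.1 hy hac ha.2 hc.2 hky
  refine ⟨k, hj, hkB, fun y hy => ⟨fun hjy => ?_, ?_⟩⟩
  swap
  · rintro (rfl | hky)
    · exact hjk
    · rcases hknot y hy hky with rfl | rfl
      exacts [haB.2, hcB.2]
  by_contra! hyk
  have hya : y ≠ a := fun h => hyk.2 (h ▸ ha.2)
  have hyc : y ≠ c := fun h => hyk.2 (h ▸ hc.2)
  -- a second vertex outside `{k, a, c}`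
  have hkacX : ({k, a, c} : Finset V) ⊆ X := by
    intro t ht
    simp only [Finset.mem_insert, Finset.mem_singleton] at ht
    rcases ht with rfl | rfl | rfl
    exacts [hkX, ha.1, hc.1]
  obtain ⟨y', hy'X, hy'⟩ : ∃ y' ∈ X, y' ∉ ({y, k, a, c} : Finset V) := by
    by_contra! hcon
    have hXe : X = {y, k, a, c} := by
      refine Finset.Subset.antisymm hcon ?_
      rw [Finset.insert_subset_iff]
      exact ⟨(memX y).2 ⟨hy, hjy⟩, hkacX⟩
    have h4 : ({y, k, a, c} : Finset V).card = 4 := by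
      rw [Finset.card_insert_of_notMem (by simp [hyk.1, hya, hyc]),
        Finset.card_insert_of_notMem (by simp [ha.2.ne, hc.2.ne]),
        Finset.card_insert_of_notMem (by simp [hac]), Finset.card_singleton]
    rw [hXe, h4] at hodd
    exact absurd hodd (by decide)
  simp only [Finset.mem_insert, Finset.mem_singleton, not_or] at hy'
  obtain ⟨hy'y, hy'k, hy'a, hy'c⟩ := hy'
  obtain ⟨hy'B, hjy'⟩ := (memX y').1 hy'X
  have hky' : ¬ G.Adj k y' := fun h => (hknot y' hy'B h).elim hy'a hy'c
  have hside : ∀ t ∈ B, G.Adj j t → t ≠ a → t ≠ c → G.Adj a t ∨ G.Adj c t := by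
    intro t htB hjt hta htc
    by_contra! hcon
    exact hcf ⟨j, a, c, t, hac, hta.symm, htc.symm, haB.2, hcB.2, hjt, hac', hcon.1, hcon.2⟩
  have hfin : ∀ a c y y' : V, a ≠ c → a ∈ B → c ∈ B → y ∈ B → y' ∈ B → G.Adj k a → G.Adj k c →
      G.Adj a y → G.Adj c y' → y ≠ y' → y ≠ k → y' ≠ k → G.Adj j y → G.Adj j y' →
      ¬ G.Adj k y → ¬ G.Adj k y' → y ≠ a → y ≠ c → y' ≠ a → y' ≠ c → False := by
    clear ha hc hyk hky' hy'k hkac hac haB hcB hya hyc hy'a hy'c hjy hjy' hy'y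
    intro a c y y' hac ha hc hy hy' hka hkc hay hcy' hyy' hyk hy'k hjy hjy' hky hky' hya hyc
      hy'a hy'c
    by_cases hadj : G.Adj y y'
    · have hS : ({k, a, c, y, y'} : Finset V) = B := by
        refine hB.1.eq_of_closed ?_ ⟨k, by simp⟩ ?_
        · intro t ht
          simp only [Finset.mem_insert, Finset.mem_singleton] at ht
          rcases ht with rfl | rfl | rfl | rfl | rfl <;> assumption
        · intro s hs t ht hst
          simp only [Finset.mem_insert, Finset.mem_singleton] at hs ⊢
          rcases hs with rfl | rfl | rfl | rfl | rfl
          · have := hB.1.eq_or_eq hkB ha hc ht hac hka hkc hst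
            tauto
          · have := hB.1.eq_or_eq ha hkB hy ht hyk.symm hka.symm hay hst
            tauto
          · have := hB.1.eq_or_eq hc hkB hy' ht hy'k.symm hkc.symm hcy' hst
            tauto
          · have := hB.1.eq_or_eq hy ha hy' ht hy'a.symm hay.symm hadj hst
            tauto
          · have := hB.1.eq_or_eq hy' hc hy ht hyc.symm hcy'.symm hadj.symm hst
            tauto
      have hev := hB.2
      have h5 : ({k, a, c, y, y'} : Finset V).card = 5 := by
        rw [Finset.card_insert_of_notMem (by simp [hka.ne, hkc.ne, hyk.symm, hy'k.symm]),
          Finset.card_insert_of_notMem (by simp [hac, hya.symm, hy'a.symm]),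
          Finset.card_insert_of_notMem (by simp [hyc.symm, hy'c.symm]),
          Finset.card_insert_of_notMem (by simp [hyy']), Finset.card_singleton]
      rw [← hS, h5] at hev
      exact absurd hev (by decide)
    · exact hcf ⟨j, k, y, y', hyk.symm, hy'k.symm, hyy', hjk, hjy, hjy', hky, hky', hadj⟩
  rcases hside y hy hjy hya hyc with h1 | h1 <;> rcases hside y' hy'B hjy' hy'a hy'c with h2 | h2
  · have := hB.1.eq_or_eq haB.1 hkB hy hy'B hyk.1.symm ha.2.symm h1 h2
    tauto
  · exact hfin a c y y' hac haB.1 hcB.1 hy hy'B ha.2 hc.2 h1 h2 (Ne.symm hy'y) hyk.1 hy'k hjy hjy'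
      hyk.2 hky' hya hyc hy'a hy'c
  · exact hfin c a y y' hac.symm hcB.1 haB.1 hy hy'B hc.2 ha.2 h1 h2 (Ne.symm hy'y) hyk.1 hy'k hjy
      hjy' hyk.2 hky' hyc hya hy'c hy'a
  · have := hB.1.eq_or_eq hcB.1 hkB hy hy'B hyk.1.symm hc.2.symm h1 h2
    tauto

end Holes


section Operators

variable {V : Type u} {d : ℕ} {G : SimpleGraph V} {h : V → Matrix (Fin d) (Fin d) ℂ}

/-- `T` and `U` commute up to the sign `(-1) ^ n`. -/
def SignComm (n : ℕ) (T U : Matrix (Fin d) (Fin d) ℂ) : Prop :=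
  T * U = (-1 : ℤ) ^ n • (U * T)

namespace SignComm

variable {n m : ℕ} {T U W : Matrix (Fin d) (Fin d) ℂ}

lemma mul_right (h₁ : SignComm n T U) (h₂ : SignComm m T W) : SignComm (n + m) T (U * W) := by
  unfold SignComm at *
  rw [← mul_assoc, h₁, smul_mul_assoc, mul_assoc, h₂, mul_smul_comm, smul_smul, pow_add, mul_assoc]

lemma symm (h₁ : SignComm n T U) : SignComm n U T := by
  unfold SignComm at *
  rw [h₁, smul_smul, ← mul_pow]
  simp

lemma commute (h₁ : SignComm n T U) (hn : Even n) : Commute T U := by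
  unfold SignComm at h₁
  rwa [hn.neg_one_pow, one_smul] at h₁

lemma anticommute (h₁ : SignComm n T U) (hn : Odd n) : T * U = -(U * T) := by
  unfold SignComm at h₁
  rwa [hn.neg_one_pow, neg_one_smul] at h₁

end SignComm

/-- The commutation relations of an operator realization. -/
structure IsRealization (G : SimpleGraph V) (h : V → Matrix (Fin d) (Fin d) ℂ) : Prop where
  sq : ∀ v, ∃ c : ℂ, c ≠ 0 ∧ h v * h v = c • (1 : Matrix (Fin d) (Fin d) ℂ)
  anti : ∀ u v, G.Adj u v → h u * h v = -(h v * h u)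
  comm : ∀ u v, u ≠ v → ¬ G.Adj u v → h u * h v = h v * h u

namespace IsRealization

lemma commute (hr : IsRealization G h) {u v : V} (huv : ¬ G.Adj u v) : Commute (h u) (h v) := by
  by_cases huv' : u = v
  · rw [huv']
  · exact hr.comm u v huv' huv

lemma signComm (hr : IsRealization G h) (u v : V) :
    SignComm (if G.Adj u v then 1 else 0) (h u) (h v) := by
  unfold SignComm
  split_ifs with huv
  · rw [hr.anti u v huv]; simp
  · rw [(hr.commute huv).eq]; simp

lemma pairwise (hr : IsRealization G h) {S : Finset V} (hS : IsIndep G S) :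
    (S : Set V).Pairwise fun u v => Commute (h u) (h v) :=
  fun u hu v hv _ => hr.commute (hS u hu v hv)

lemma eq_zero_of_mul_eq_zero (hr : IsRealization G h) {v : V} {T : Matrix (Fin d) (Fin d) ℂ}
    (hT : T * h v = 0) : T = 0 := by
  obtain ⟨c, hc, hcv⟩ := hr.sq v
  have : T * h v * h v = 0 := by rw [hT, zero_mul]
  rw [mul_assoc, hcv, mul_smul_comm, mul_one] at this
  exact (smul_eq_zero.1 this).resolve_left hc

end IsRealization

lemma hProd_empty (h : V → Matrix (Fin d) (Fin d) ℂ) : hProd h ∅ = 1 := by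
  simp [hProd]

lemma IsIndep.mono {S T : Finset V} (hT : IsIndep G T) (hST : S ⊆ T) : IsIndep G S :=
  fun u hu v hv => hT u (hST hu) v (hST hv)

variable [DecidableEq V]

lemma hProd_insert (hr : IsRealization G h) {S : Finset V} {v : V} (hv : v ∉ S)
    (hS : IsIndep G (insert v S)) : hProd h (insert v S) = h v * hProd h S := by
  have h1 := hr.pairwise hS
  have h2 := hr.pairwise (hS.mono (Finset.subset_insert v S))
  rw [hProd, hProd, dif_pos h2, dif_pos h1, Finset.noncommProd_insert_of_notMem _ _ _ _ hv]

lemma SignComm.hProd (hr : IsRealization G h) {S : Finset V} (hS : IsIndep G S) {f : V → ℕ}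
    {T : Matrix (Fin d) (Fin d) ℂ} (hT : ∀ v ∈ S, SignComm (f v) T (h v)) :
    SignComm (∑ v ∈ S, f v) T (hProd h S) := by
  induction S using Finset.induction_on with
  | empty => simp [hProd_empty, SignComm]
  | insert v S hv ih =>
    rw [hProd_insert hr hv hS, Finset.sum_insert hv]
    exact (hT v (Finset.mem_insert_self _ _)).mul_right
      (ih (hS.mono (Finset.subset_insert v S)) fun w hw => hT w (Finset.mem_insert_of_mem hw))

lemma IsRealization.signComm_hProd (hr : IsRealization G h) {S : Finset V} (hS : IsIndep G S)
    (v : V) : SignComm (S.filter fun u => G.Adj v u).card (h v) (hProd h S) := by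
  rw [Finset.card_filter]
  exact SignComm.hProd hr hS fun u _ => hr.signComm v u

/-- `X` and `Y` are the classes of a bipartition of `B`. -/
def IsBipartition (G : SimpleGraph V) (B X Y : Finset V) : Prop :=
  X ∪ Y = B ∧ Disjoint X Y ∧ IsIndep G X ∧ IsIndep G Y

lemma IsBipartition.swap {B X Y : Finset V} (hp : IsBipartition G B X Y) :
    IsBipartition G B Y X :=
  ⟨Finset.union_comm X Y ▸ hp.1, hp.2.1.symm, hp.2.2.2, hp.2.2.1⟩

lemma holeOp_eq_zero_or (G : SimpleGraph V) (h : V → Matrix (Fin d) (Fin d) ℂ) (B : Finset V) :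
    ((¬ ∃ X Y, IsBipartition G B X Y) ∧ holeOp G h B = 0) ∨
      ∃ X Y, IsBipartition G B X Y ∧ holeOp G h B = hProd h X * hProd h Y := by
  unfold holeOp
  split_ifs with hx
  · exact Or.inr ⟨_, _, hx.choose_spec, rfl⟩
  · exact Or.inl ⟨fun ⟨X, Y, hXY⟩ => hx ⟨(X, Y), hXY⟩, rfl⟩

lemma IsBipartition.signComm {B X Y : Finset V} (hp : IsBipartition G B X Y)
    (hr : IsRealization G h) {f : V → ℕ} {T : Matrix (Fin d) (Fin d) ℂ}
    (hT : ∀ v ∈ B, SignComm (f v) T (h v)) :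
    SignComm (∑ v ∈ B, f v) T (hProd h X * hProd h Y) := by
  obtain ⟨rfl, hd, hX, hY⟩ := hp
  rw [Finset.sum_union hd]
  exact (SignComm.hProd hr hX fun v hv => hT v (Finset.mem_union_left _ hv)).mul_right
    (SignComm.hProd hr hY fun v hv => hT v (Finset.mem_union_right _ hv))

lemma IsRealization.signComm_hole_right (hr : IsRealization G h) {B : Finset V} {f : V → ℕ}
    {T : Matrix (Fin d) (Fin d) ℂ} (hT : ∀ v ∈ B, SignComm (f v) T (h v)) :
    SignComm (∑ v ∈ B, f v) T (holeOp G h B) := by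
  obtain ⟨-, h0⟩ | ⟨X, Y, hp, hXY⟩ := holeOp_eq_zero_or G h B
  · simp [h0, SignComm]
  · rw [hXY]; exact hp.signComm hr hT

lemma IsRealization.signComm_holeOp (hr : IsRealization G h) (v : V) (B : Finset V) :
    SignComm (B.filter fun u => G.Adj v u).card (h v) (holeOp G h B) := by
  rw [Finset.card_filter]
  exact hr.signComm_hole_right fun u _ => hr.signComm v u

lemma IsRealization.signComm_holeOp_holeOp (hr : IsRealization G h) (A B : Finset V) :
    SignComm (∑ v ∈ B, (A.filter fun u => G.Adj v u).card) (holeOp G h A) (holeOp G h B) :=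
  hr.signComm_hole_right fun v _ => (hr.signComm_holeOp v A).symm

lemma IsBipartition.filter_eq {B X Y : Finset V} (hp : IsBipartition G B X Y) {x : V}
    (hx : x ∈ X) : (Y.filter fun u => G.Adj x u) = B.filter fun u => G.Adj x u := by
  obtain ⟨rfl, hd, hX, hY⟩ := hp
  rw [Finset.filter_union, Finset.filter_false_of_mem (fun u hu => hX x hx u hu),
    Finset.empty_union]

lemma IsBipartition.commute {B X Y : Finset V} (hp : IsBipartition G B X Y)
    (hr : IsRealization G h) (hB : IsHole G B) : Commute (hProd h X) (hProd h Y) := by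
  have hs : SignComm (∑ x ∈ X, 2) (hProd h Y) (hProd h X) := by
    refine SignComm.hProd hr hp.2.2.1 fun x hx => ?_
    rw [← hB.2.2 x (hp.1 ▸ Finset.mem_union_left _ hx), ← hp.filter_eq hx]
    exact (hr.signComm_hProd hp.2.2.2 x).symm
  refine (hs.commute ?_).symm
  simp

lemma IsBipartition.mem_iff {B X Y : Finset V} (hp : IsBipartition G B X Y) {s b : V}
    (hs : s ∈ B) (hb : b ∈ B) (hsb : G.Adj s b) : s ∈ X ↔ b ∉ X := by
  obtain ⟨rfl, hd, hX, hY⟩ := hp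
  rw [Finset.mem_union] at hs hb
  constructor
  · exact fun h1 h2 => hX s h1 b h2 hsb
  · exact fun h1 => hs.resolve_right fun h2 => hY s h2 b (hb.resolve_left h1) hsb

lemma IsBipartition.right_eq {B X Y : Finset V} (hp : IsBipartition G B X Y) : Y = B \ X := by
  obtain ⟨rfl, hd, -, -⟩ := hp
  rw [Finset.union_sdiff_left, Finset.sdiff_eq_self_of_disjoint hd.symm]

lemma IsBipartition.left_subset {B X Y : Finset V} (hp : IsBipartition G B X Y) : X ⊆ B :=
  hp.1 ▸ Finset.subset_union_left

lemma IsBipartition.eq_or_eq {B X Y X' Y' : Finset V} (hB : IsHole G B)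
    (hp : IsBipartition G B X Y) (hp' : IsBipartition G B X' Y') : X = X' ∨ X = Y' := by
  rcases (B.filter fun v => v ∈ X ↔ v ∈ X').eq_empty_or_nonempty with he | hne
  · right
    ext v
    rw [hp'.right_eq, Finset.mem_sdiff]
    have := fun hv : v ∈ B => Finset.filter_eq_empty_iff.1 he hv
    have := fun hv : v ∈ X => hp.left_subset hv
    tauto
  · left
    have := hB.eq_of_closed (Finset.filter_subset _ _) hne fun s hs b hb hsb => by
      rw [Finset.mem_filter] at hs ⊢
      have h1 := hp.mem_iff hs.1 hb hsb
      have h2 := hp'.mem_iff hs.1 hb hsb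
      tauto
    ext v
    have h1 : v ∈ B → _ := fun hv => (Finset.mem_filter.1 (this ▸ hv)).2
    have h2 := fun hv : v ∈ X => hp.left_subset hv
    have h3 := fun hv : v ∈ X' => hp'.left_subset hv
    tauto

lemma IsBipartition.holeOp_eq {B X Y : Finset V} (hp : IsBipartition G B X Y)
    (hr : IsRealization G h) (hB : IsHole G B) : holeOp G h B = hProd h X * hProd h Y := by
  obtain ⟨h0, -⟩ | ⟨X', Y', hp', hXY⟩ := holeOp_eq_zero_or G h B
  · exact absurd ⟨X, Y, hp⟩ h0
  · rw [hXY]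
    rcases hp.eq_or_eq hB hp' with rfl | rfl
    · rw [hp.right_eq, hp'.right_eq]
    · rw [hp.right_eq, ← hp'.swap.right_eq, (hp'.commute hr hB).eq]

/-- Replacing a vertex by a twin turns a bipartition into a bipartition. -/
lemma Twin.isBipartition {B X Y : Finset V} {j k : V} (ht : Twin G B j k)
    (hp : IsBipartition G B X Y) (hk : k ∈ X) :
    IsBipartition G (insert j (B.erase k)) (insert j (X.erase k)) Y := by
  have hkY : k ∉ Y := Finset.disjoint_left.1 hp.2.1 hk
  have hjX : ∀ x ∈ X.erase k, ¬ G.Adj j x := fun x hx hjx => by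
    rw [Finset.mem_erase] at hx
    exact ((ht.2.2 x (hp.left_subset hx.2)).1 hjx).elim hx.1 (hp.2.2.1 k hk x hx.2)
  refine ⟨?_, ?_, ?_, hp.2.2.2⟩
  · rw [Finset.insert_union, ← hp.1, Finset.erase_union_distrib, Finset.erase_eq_of_notMem hkY]
  · rw [Finset.disjoint_insert_left]
    exact ⟨fun hj => ht.1 (hp.swap.left_subset hj), hp.2.1.mono_left (Finset.erase_subset _ _)⟩
  · intro u hu v hv
    rw [Finset.mem_insert] at hu hv
    rcases hu with rfl | hu <;> rcases hv with rfl | hv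
    · exact G.loopless.irrefl _
    · exact hjX v hv
    · exact fun h => hjX u hu h.symm
    · exact hp.2.2.1 u (Finset.mem_of_mem_erase hu) v (Finset.mem_of_mem_erase hv)

lemma Twin.lie_add_lie (hr : IsRealization G h) {B : Finset V} (hB : IsHole G B) {j k : V}
    (ht : Twin G B j k) :
    ⁅holeOp G h B, h j⁆ + ⁅holeOp G h (insert j (B.erase k)), h k⁆ = 0 := by
  have key : ∀ X Y, IsBipartition G B X Y → k ∈ X →
      ⁅holeOp G h B, h j⁆ + ⁅holeOp G h (insert j (B.erase k)), h k⁆ = 0 := by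
    intro X Y hp hk
    have hp' := ht.isBipartition hp hk
    have hj : j ∉ X.erase k := fun hj => ht.1 (hp.left_subset (Finset.mem_of_mem_erase hj))
    have hq : IsBipartition G (B.erase k) (X.erase k) Y := by
      refine ⟨?_, hp.2.1.mono_left (Finset.erase_subset _ _),
        hp.2.2.1.mono (Finset.erase_subset _ _), hp.2.2.2⟩
      rw [← hp.1, Finset.erase_union_distrib,
        Finset.erase_eq_of_notMem (Finset.disjoint_left.1 hp.2.1 hk)]
    have hQ : ∀ v, ((B.erase k).filter fun u => G.Adj v u).card = 2 →
        Commute (h v) (hProd h (X.erase k) * hProd h Y) := fun v hv => by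
      refine SignComm.commute (n := ((B.erase k).filter fun u => G.Adj v u).card) ?_ ?_
      · rw [Finset.card_filter]
        exact hq.signComm hr fun u _ => hr.signComm v u
      · rw [hv]; exact even_two
    have hQk := hQ k <| by
      rw [Finset.filter_erase, Finset.erase_eq_of_notMem (by simp), hB.2.2 k ht.2.1]
    have hQj := hQ j <| by
      rw [Finset.filter_erase, ht.filter_eq, Finset.erase_insert (by simp), hB.2.2 k ht.2.1]
    have h1 : holeOp G h B = h k * (hProd h (X.erase k) * hProd h Y) := by
      rw [hp.holeOp_eq hr hB, ← mul_assoc, ← hProd_insert hr (Finset.notMem_erase k X)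
        (by rw [Finset.insert_erase hk]; exact hp.2.2.1), Finset.insert_erase hk]
    have h2 : holeOp G h (insert j (B.erase k)) = h j * (hProd h (X.erase k) * hProd h Y) := by
      rw [hp'.holeOp_eq hr (ht.isHole hB), ← mul_assoc, ← hProd_insert hr hj hp'.2.2.1]
    rw [h1, h2, Ring.lie_def, Ring.lie_def, mul_assoc (h k), mul_assoc (h j), ← hQj.eq, ← hQk.eq]
    noncomm_ring
  by_cases hx : ∃ X Y, IsBipartition G B X Y
  · obtain ⟨X, Y, hp⟩ := hx
    have hk : k ∈ X ∪ Y := hp.1 ▸ ht.2.1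
    rcases Finset.mem_union.1 hk with hk | hk
    exacts [key X Y hp hk, key Y X hp.swap hk]
  · have hx' : ¬ ∃ X Y, IsBipartition G (insert j (B.erase k)) X Y := by
      rintro ⟨X, Y, hp⟩
      have hj : j ∈ X ∪ Y := hp.1 ▸ Finset.mem_insert_self _ _
      have hback : ∀ X Y, IsBipartition G (insert j (B.erase k)) X Y → j ∈ X → False :=
        fun X Y hp hj => hx ⟨_, _, ht.swap_back ▸ ht.symm.isBipartition hp hj⟩
      rcases Finset.mem_union.1 hj with hj | hj
      exacts [hback X Y hp hj, hback Y X hp.swap hj]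
    obtain ⟨-, h1⟩ | ⟨X, Y, hp, -⟩ := holeOp_eq_zero_or G h B
    · obtain ⟨-, h2⟩ | ⟨X, Y, hp, -⟩ := holeOp_eq_zero_or G h (insert j (B.erase k))
      · simp [h1, h2, Ring.lie_def]
      · exact absurd ⟨X, Y, hp⟩ hx'
    · exact absurd ⟨X, Y, hp⟩ hx

end Operators

section Components

variable {V : Type u} [DecidableEq V] {d : ℕ} {G : SimpleGraph V}
  {h : V → Matrix (Fin d) (Fin d) ℂ}

/-- The integer-valued indicator function of a finite set. -/
def ind (B : Finset V) (v : V) : ℤ := if v ∈ B then 1 else 0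

lemma ind_of_mem {B : Finset V} {v : V} (hv : v ∈ B) : ind B v = 1 := if_pos hv

lemma ind_of_notMem {B : Finset V} {v : V} (hv : v ∉ B) : ind B v = 0 := if_neg hv

lemma Twin.ind_add_single {B : Finset V} {j k : V} (ht : Twin G B j k) :
    ind (insert j (B.erase k)) + Pi.single k 1 = ind B + Pi.single j 1 := by
  funext v
  have hjk := ht.ne
  have hj := ht.1
  have hk := ht.2.1
  simp only [Pi.add_apply, Pi.single_apply, ind, Finset.mem_insert, Finset.mem_erase]
  by_cases h1 : v = j <;> by_cases h2 : v = k <;> simp_all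

/-- A family of even holes that is closed under exchanging twins. -/
structure TwinClosed (G : SimpleGraph V) (K : Finset (Finset V)) : Prop where
  isEvenHole : ∀ B ∈ K, IsEvenHole G B
  swap_mem : ∀ B ∈ K, ∀ j k, Twin G B j k → insert j (B.erase k) ∈ K

variable [Fintype V]

lemma twinClosed_deformClosure (G : SimpleGraph V) (C : Finset V) :
    TwinClosed G (deformClosure G C) where
  isEvenHole B hB := (Finset.mem_filter.1 hB).2.1
  swap_mem B hB j k ht := by
    obtain ⟨-, hB1, hB2⟩ := Finset.mem_filter.1 hB
    exact Finset.mem_filter.2 ⟨Finset.mem_univ _, ht.isEvenHole hB1, hB2.tail (ht.deform hB1.1)⟩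

lemma TwinClosed.sum_smul_lie (hcf : ClawFree G) (hr : IsRealization G h)
    {K : Finset (Finset V)} (hK : TwinClosed G K) (φ : (V → ℤ) → ℤ) :
    ∑ B ∈ K, ∑ j, φ (ind B + Pi.single j 1) • ⁅holeOp G h B, h j⁆ = 0 := by
  set F : Finset V → V → Matrix (Fin d) (Fin d) ℂ := fun B j =>
    φ (ind B + Pi.single j 1) • ⁅holeOp G h B, h j⁆ with hF
  have hexp : ∀ B ∈ K, ∀ j, F B j = ∑ k, if Twin G B j k then F B j else 0 := by
    intro B hB j
    have hBe := hK.isEvenHole B hB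
    by_cases hex : ∃ k, Twin G B j k
    · obtain ⟨k, hk⟩ := hex
      rw [Finset.sum_eq_single k (fun k' _ hk' => if_neg fun ht => hk' (ht.unique hBe.1 hk))
        (fun hk' => absurd (Finset.mem_univ _) hk'), if_pos hk]
    · have heven : Even (B.filter fun u => G.Adj j u).card := by
        by_contra hodd
        exact hex (hBe.exists_twin hcf (Nat.not_even_iff_odd.1 hodd))
      have h0 : F B j = 0 := by
        rw [hF]
        simp only [Ring.lie_def]
        rw [((hr.signComm_holeOp j B).commute heven).eq, sub_self, smul_zero]
      rw [h0]
      simp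
  have hsum : ∑ B ∈ K, ∑ j, F B j = ∑ p ∈ (K ×ˢ (Finset.univ : Finset V) ×ˢ
      (Finset.univ : Finset V)).filter (fun p => Twin G p.1 p.2.1 p.2.2), F p.1 p.2.1 := by
    rw [Finset.sum_filter, Finset.sum_product]
    refine Finset.sum_congr rfl fun B hB => ?_
    rw [Finset.sum_product]
    exact Finset.sum_congr rfl fun j _ => hexp B hB j
  rw [hsum]
  have hmem : ∀ p : Finset V × V × V, p ∈ (K ×ˢ (Finset.univ : Finset V) ×ˢ
      (Finset.univ : Finset V)).filter (fun p => Twin G p.1 p.2.1 p.2.2) ↔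
      p.1 ∈ K ∧ Twin G p.1 p.2.1 p.2.2 := fun p => by simp
  refine Finset.sum_involution (fun p _ => (insert p.2.1 (p.1.erase p.2.2), p.2.2, p.2.1))
    ?_ ?_ ?_ ?_
  · rintro ⟨B, j, k⟩ hp
    obtain ⟨hB, ht⟩ := (hmem _).1 hp
    simp only [hF]
    dsimp only at hB ht
    rw [ht.ind_add_single, ← smul_add, ht.lie_add_lie hr (hK.isEvenHole B hB).1, smul_zero]
  · rintro ⟨B, j, k⟩ hp _ heq
    exact ((hmem _).1 hp).2.ne (Prod.ext_iff.1 (Prod.ext_iff.1 heq).2).2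
  · rintro ⟨B, j, k⟩ hp
    obtain ⟨hB, ht⟩ := (hmem _).1 hp
    exact (hmem _).2 ⟨hK.swap_mem B hB j k ht, ht.symm⟩
  · rintro ⟨B, j, k⟩ hp
    obtain ⟨hB, ht⟩ := (hmem _).1 hp
    dsimp only at ht ⊢
    rw [ht.swap_back]

/-- The component of multidegree `m` in the commutator of the two cycle symmetries. -/
noncomputable def commComponent (G : SimpleGraph V) (h : V → Matrix (Fin d) (Fin d) ℂ)
    (K K' : Finset (Finset V)) (m : V → ℤ) : Matrix (Fin d) (Fin d) ℂ :=
  ∑ A ∈ K, ∑ B ∈ K', (if ind A + ind B = m then (1 : ℤ) else 0) • ⁅holeOp G h A, holeOp G h B⁆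

lemma sum_lie_commComponent (hcf : ClawFree G) (hr : IsRealization G h)
    {K K' : Finset (Finset V)} (hK : TwinClosed G K) (hK' : TwinClosed G K') (n : V → ℤ) :
    ∑ i, ⁅commComponent G h K K' (n - Pi.single i 1), h i⁆ = 0 := by
  let := LieRing.ofAssociativeRing (A := Matrix (Fin d) (Fin d) ℂ)
  have hA : ∀ A : Finset V, ∑ B ∈ K', ∑ i, (if ind A + (ind B + Pi.single i 1) = n then (1 : ℤ)
      else 0) • ⁅holeOp G h A, ⁅holeOp G h B, h i⁆⁆ = 0 := fun A => by
    have := hK'.sum_smul_lie hcf hr fun q => if ind A + q = n then (1 : ℤ) else 0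
    simpa only [lie_sum, lie_zero, lie_zsmul] using congrArg (fun T => ⁅holeOp G h A, T⁆) this
  have hB : ∀ B : Finset V, ∑ A ∈ K, ∑ i, (if ind B + (ind A + Pi.single i 1) = n then (1 : ℤ)
      else 0) • ⁅holeOp G h B, ⁅holeOp G h A, h i⁆⁆ = 0 := fun B => by
    have := hK.sum_smul_lie hcf hr fun q => if ind B + q = n then (1 : ℤ) else 0
    simpa only [lie_sum, lie_zero, lie_zsmul] using congrArg (fun T => ⁅holeOp G h B, T⁆) this
  have key : ∑ i, ⁅commComponent G h K K' (n - Pi.single i 1), h i⁆ =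
      ∑ A ∈ K, ∑ B ∈ K', ∑ i, (if ind A + (ind B + Pi.single i 1) = n then (1 : ℤ)
        else 0) • ⁅holeOp G h A, ⁅holeOp G h B, h i⁆⁆ -
      ∑ B ∈ K', ∑ A ∈ K, ∑ i, (if ind B + (ind A + Pi.single i 1) = n then (1 : ℤ)
        else 0) • ⁅holeOp G h B, ⁅holeOp G h A, h i⁆⁆ := by
    rw [Finset.sum_comm (s := K'), ← Finset.sum_sub_distrib]
    simp only [← Finset.sum_sub_distrib, commComponent, sum_lie, zsmul_lie]
    rw [Finset.sum_comm]
    refine Finset.sum_congr rfl fun A _ => ?_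
    rw [Finset.sum_comm]
    refine Finset.sum_congr rfl fun B _ => Finset.sum_congr rfl fun i _ => ?_
    rw [lie_lie, smul_sub]
    congr 2 <;> refine if_congr ?_ rfl rfl
    · rw [eq_sub_iff_add_eq, add_assoc]
    · rw [eq_sub_iff_add_eq, add_comm (ind A), add_assoc]
  rw [key, Finset.sum_eq_zero fun A _ => hA A, Finset.sum_eq_zero fun B _ => hB B, sub_zero]

end Components

section Degrees

variable {V : Type u} [Fintype V] {G : SimpleGraph V}

/-- The sum of a weight function over the neighbors of a vertex. -/
noncomputable def wdeg (G : SimpleGraph V) (m : V → ℤ) (v : V) : ℤ :=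
  ∑ u, if G.Adj v u then m u else 0

lemma wdeg_add (m n : V → ℤ) (v : V) : wdeg G (m + n) v = wdeg G m v + wdeg G n v := by
  simp only [wdeg, ← Finset.sum_add_distrib]
  exact Finset.sum_congr rfl fun u _ => by split_ifs <;> simp

lemma wdeg_sub (m n : V → ℤ) (v : V) : wdeg G (m - n) v = wdeg G m v - wdeg G n v := by
  simp only [wdeg, ← Finset.sum_sub_distrib]
  exact Finset.sum_congr rfl fun u _ => by split_ifs <;> simp

variable [DecidableEq V]

lemma wdeg_single (i v : V) : wdeg G (Pi.single i 1) v = if G.Adj v i then 1 else 0 := by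
  rw [wdeg, Finset.sum_eq_single i]
  · simp
  · intro u _ hu
    simp [Pi.single_eq_of_ne hu]
  · simp

lemma wdeg_ind (B : Finset V) (v : V) :
    wdeg G (ind B) v = (B.filter fun u => G.Adj v u).card := by
  rw [Finset.card_filter, Nat.cast_sum, wdeg, ← Finset.sum_subset (Finset.subset_univ B)]
  · exact Finset.sum_congr rfl fun u hu => by simp [ind_of_mem hu]
  · exact fun u _ hu => by simp [ind_of_notMem hu]

lemma wdeg_exchange (m : V → ℤ) (i j v : V) :
    wdeg G (m + Pi.single j 1 - Pi.single i 1) v =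
      wdeg G m v + (if G.Adj v j then 1 else 0) - if G.Adj v i then 1 else 0 := by
  rw [wdeg_sub, wdeg_add, wdeg_single, wdeg_single]

variable {d : ℕ} {h : V → Matrix (Fin d) (Fin d) ℂ}

lemma signComm_commComponent (hr : IsRealization G h) (K K' : Finset (Finset V)) (m : V → ℤ)
    (i : V) : SignComm (wdeg G m i).natAbs (h i) (commComponent G h K K' m) := by
  unfold SignComm commComponent
  simp only [Finset.mul_sum, Finset.sum_mul, Finset.smul_sum]
  refine Finset.sum_congr rfl fun A _ => Finset.sum_congr rfl fun B _ => ?_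
  split_ifs with hm
  · have hw : (wdeg G m i).natAbs =
        (A.filter fun u => G.Adj i u).card + (B.filter fun u => G.Adj i u).card := by
      rw [← hm, wdeg_add, wdeg_ind, wdeg_ind]
      omega
    have h1 := (hr.signComm_holeOp i A).mul_right (hr.signComm_holeOp i B)
    have h2 := (hr.signComm_holeOp i B).mul_right (hr.signComm_holeOp i A)
    rw [← hw] at h1
    rw [add_comm, ← hw] at h2
    unfold SignComm at h1 h2
    rw [one_smul, Ring.lie_def, mul_sub, h1, h2, sub_mul, smul_sub]
  · simp

lemma commComponent_ne_zero {K K' : Finset (Finset V)} {m : V → ℤ} (hr : IsRealization G h)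
    (hm : commComponent G h K K' m ≠ 0) : ∃ A ∈ K, ∃ B ∈ K', ind A + ind B = m ∧
      Odd (∑ v ∈ B, (A.filter fun u => G.Adj v u).card) := by
  by_contra! hcon
  refine hm (Finset.sum_eq_zero fun A hA => Finset.sum_eq_zero fun B hB => ?_)
  split_ifs with hAB
  · have := (hr.signComm_holeOp_holeOp A B).commute
      (Nat.not_odd_iff_even.1 (hcon A hA B hB hAB))
    rw [Ring.lie_def, this.eq, sub_self, smul_zero]
  · rw [zero_smul]

lemma exists_exchange (hcf : ClawFree G) (hr : IsRealization G h) {K K' : Finset (Finset V)}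
    (hK : TwinClosed G K) (hK' : TwinClosed G K') {m : V → ℤ} {j : V}
    (hm : commComponent G h K K' m ≠ 0) (hj : Odd (wdeg G m j)) :
    ∃ i ≠ j, commComponent G h K K' (m + Pi.single j 1 - Pi.single i 1) ≠ 0 ∧
      Odd (wdeg G (m + Pi.single j 1 - Pi.single i 1) i) := by
  by_contra! hcon
  have hsum := sum_lie_commComponent hcf hr hK hK' (m + Pi.single j 1)
  rw [Finset.sum_eq_single j _ (fun hj' => absurd (Finset.mem_univ _) hj'), add_sub_cancel_right]
    at hsum
  · have ha := (signComm_commComponent hr K K' m j).anticommute (Int.natAbs_odd.2 hj)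
    rw [Ring.lie_def, ha, sub_neg_eq_add, ← two_smul ℂ] at hsum
    exact hm (hr.eq_zero_of_mul_eq_zero ((smul_eq_zero.1 hsum).resolve_left two_ne_zero))
  · intro i _ hij
    by_cases h0 : commComponent G h K K' (m + Pi.single j 1 - Pi.single i 1) = 0
    · rw [h0, Ring.lie_def, zero_mul, mul_zero, sub_zero]
    · have heven := Int.not_odd_iff_even.1 (hcon i hij h0)
      have := (signComm_commComponent hr K K' _ i).commute (Int.natAbs_even.2 heven)
      rw [Ring.lie_def, this.eq, sub_self]

end Degrees

section DoubleSet

variable {V : Type u} [Fintype V]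

/-- The set of vertices of weight two. -/
def doubleSet (m : V → ℤ) : Finset V := Finset.univ.filter fun v => m v = 2

lemma mem_doubleSet {m : V → ℤ} {v : V} : v ∈ doubleSet m ↔ m v = 2 := by
  simp [doubleSet]

/-- `m` satisfies `N` and has as many vertices of weight two as possible. -/
def MaxDouble (N : (V → ℤ) → Prop) (m : V → ℤ) : Prop :=
  N m ∧ ∀ m', N m' → (doubleSet m').card ≤ (doubleSet m).card

lemma exists_maxDouble {N : (V → ℤ) → Prop} {m₀ : V → ℤ} (h₀ : N m₀) : ∃ m, MaxDouble N m := by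
  obtain ⟨m, hm, hmin⟩ := (measure fun m : V → ℤ =>
    Fintype.card V - (doubleSet m).card).wf.has_min {m | N m} ⟨m₀, h₀⟩
  refine ⟨m, hm, fun m' hm' => ?_⟩
  have h1 : ¬ Fintype.card V - (doubleSet m').card < Fintype.card V - (doubleSet m).card :=
    hmin m' hm'
  have h2 := Finset.card_le_univ (doubleSet m)
  have h3 := Finset.card_le_univ (doubleSet m')
  omega

end DoubleSet

section Exchange

variable {V : Type u} [DecidableEq V] {G : SimpleGraph V}

lemma ind_insert {B : Finset V} {v : V} (hv : v ∉ B) :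
    ind (insert v B) = ind B + Pi.single v 1 := by
  funext w
  simp only [ind, Pi.add_apply, Pi.single_apply, Finset.mem_insert]
  by_cases hw : w = v
  · subst hw; simp [hv]
  · simp [hw]

/-- `m` is the sum of the indicators of the hole `A` and the even hole `B`. -/
structure Split (G : SimpleGraph V) (m : V → ℤ) (A B : Finset V) : Prop where
  left : IsHole G A
  right : IsEvenHole G B
  sum : ind A + ind B = m

namespace Split

variable {m : V → ℤ} {A B : Finset V}

lemma apply (hs : Split G m A B) (v : V) :
    m v = (if v ∈ A then 1 else 0) + if v ∈ B then 1 else 0 := by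
  rw [← hs.sum]
  simp [ind]

lemma eq_two_iff (hs : Split G m A B) (v : V) : m v = 2 ↔ v ∈ A ∧ v ∈ B := by
  rw [hs.apply]
  split_ifs <;> simp_all

lemma one_le (hs : Split G m A B) {v : V} (hv : v ∈ B) : m v = 1 ∨ m v = 2 := by
  rw [hs.apply]
  split_ifs <;> simp

lemma nonneg_le_two (hs : Split G m A B) (v : V) : 0 ≤ m v ∧ m v ≤ 2 := by
  rw [hs.apply]
  split_ifs <;> simp

lemma mem_or (hs : Split G m A B) {v : V} (hv : m v = 1) : v ∈ A ∨ v ∈ B := by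
  rw [hs.apply] at hv
  by_contra! hcon
  simp [hcon.1, hcon.2] at hv

variable [Fintype V]

lemma wdeg_eq (hs : Split G m A B) (v : V) : wdeg G m v =
    (A.filter fun u => G.Adj v u).card + (B.filter fun u => G.Adj v u).card := by
  rw [← hs.sum, wdeg_add, wdeg_ind, wdeg_ind]

lemma wdeg_eq_four (hs : Split G m A B) {v : V} (hv : m v = 2) : wdeg G m v = 4 := by
  obtain ⟨h1, h2⟩ := (hs.eq_two_iff v).1 hv
  rw [hs.wdeg_eq, hs.left.2.2 v h1, hs.right.1.2.2 v h2]
  norm_num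

lemma eq_one_of_odd (hs : Split G m A B) {v : V} (hv : v ∈ B) (ho : Odd (wdeg G m v)) :
    m v = 1 := by
  refine (hs.one_le hv).resolve_right fun h2 => ?_
  rw [hs.wdeg_eq_four h2] at ho
  exact absurd ho (by decide)

end Split

variable [Fintype V]

/-- A set of weight functions which are sums of two holes meeting oddly, and which is closed under
some exchange at every vertex of odd degree. -/
structure ExchangeSystem (G : SimpleGraph V) (N : (V → ℤ) → Prop) : Prop where
  split : ∀ m, N m → ∃ A B, Split G m A B ∧ Odd (∑ v ∈ B, (A.filter fun u => G.Adj v u).card)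
  exchange : ∀ m j, N m → Odd (wdeg G m j) → ∃ i ≠ j, N (m + Pi.single j 1 - Pi.single i 1) ∧
    Odd (wdeg G (m + Pi.single j 1 - Pi.single i 1) i)

lemma MaxDouble.exists_exchange {N : (V → ℤ) → Prop} (hN : ExchangeSystem G N) {m : V → ℤ}
    (hm : MaxDouble N m) {j : V} (hj1 : m j = 1) (hodd : Odd (wdeg G m j)) :
    ∃ p, m p = 2 ∧ G.Adj p j ∧ MaxDouble N (m + Pi.single j 1 - Pi.single p 1) ∧
      ∀ w, m w = 2 → w ≠ p → ¬ G.Adj w p ∧ ¬ G.Adj w j := by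
  obtain ⟨i, hij, hm', ho⟩ := hN.exchange m j hm.1 hodd
  obtain ⟨A, B, hs, -⟩ := hN.split m hm.1
  obtain ⟨A', B', hs', -⟩ := hN.split _ hm'
  have hval : ∀ v, (m + Pi.single j 1 - Pi.single i 1 : V → ℤ) v =
      m v + (if v = j then 1 else 0) - if v = i then 1 else 0 := fun v => by
    simp [Pi.single_apply]
  set m' := m + Pi.single j 1 - Pi.single i 1
  have hjD : j ∉ doubleSet m := fun h => by rw [mem_doubleSet] at h; omega
  have hi2 : m i = 2 := by
    by_contra hi2
    have h1 := hs'.nonneg_le_two i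
    have h2 := hs.nonneg_le_two i
    rw [hval, if_neg hij, if_pos rfl] at h1
    have hsub : insert j (doubleSet m) ⊆ doubleSet m' := by
      intro v hv
      rw [mem_doubleSet, hval]
      rcases Finset.mem_insert.1 hv with rfl | hv
      · rw [if_pos rfl, if_neg (Ne.symm hij)]; omega
      · rw [if_neg (fun h : v = j => hjD (h ▸ hv)),
          if_neg (fun h : v = i => hi2 (h ▸ mem_doubleSet.1 hv))]
        rw [mem_doubleSet] at hv
        omega
    have h3 := Finset.card_le_card hsub
    rw [Finset.card_insert_of_notMem hjD] at h3
    have := hm.2 m' hm'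
    omega
  have hw : ∀ v, wdeg G m' v = wdeg G m v + (if G.Adj v j then 1 else 0) -
    if G.Adj v i then 1 else 0 := wdeg_exchange m i j
  have hadj : G.Adj i j := by
    by_contra hadj
    rw [hw, hs.wdeg_eq_four hi2, if_neg hadj, if_neg (G.loopless.irrefl i)] at ho
    exact absurd ho (by decide)
  refine ⟨i, hi2, hadj, ⟨hm', fun m'' hm'' => (hm.2 m'' hm'').trans ?_⟩, fun w hw2 hwi => ?_⟩
  · have hsub : insert j ((doubleSet m).erase i) ⊆ doubleSet m' := by
      intro v hv
      rw [mem_doubleSet, hval]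
      rcases Finset.mem_insert.1 hv with rfl | hv
      · rw [if_pos rfl, if_neg (Ne.symm hij)]; omega
      · obtain ⟨hvi, hv⟩ := Finset.mem_erase.1 hv
        rw [if_neg (fun h : v = j => hjD (h ▸ hv)), if_neg hvi]
        rw [mem_doubleSet] at hv
        omega
    have h3 := Finset.card_le_card hsub
    rwa [Finset.card_insert_of_notMem (fun h => hjD (Finset.mem_of_mem_erase h)),
      Finset.card_erase_add_one (mem_doubleSet.2 hi2)] at h3
  · have hwj : w ≠ j := by rintro rfl; omega
    have hw4 : wdeg G m' w = 4 := hs'.wdeg_eq_four (by rw [hval, if_neg hwj, if_neg hwi]; omega)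
    rw [hw, hs.wdeg_eq_four hw2] at hw4
    have hiff : ¬ (G.Adj w i ∧ G.Adj w j) := by
      rintro ⟨h1, h2⟩
      obtain ⟨hiA, hiB⟩ := (hs.eq_two_iff i).1 hi2
      obtain ⟨hwA, hwB⟩ := (hs.eq_two_iff w).1 hw2
      rcases hs.mem_or hj1 with hj | hj
      · exact hs.left.not_triangle hwA hiA hj h1 hadj h2
      · exact hs.right.1.not_triangle hwB hiB hj h1 hadj h2
    by_cases h1 : G.Adj w i <;> by_cases h2 : G.Adj w j
    · exact absurd ⟨h1, h2⟩ hiff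
    · simp [h1, h2] at hw4
    · simp [h1, h2] at hw4
    · exact ⟨h1, h2⟩

end Exchange

section Chains

variable {V : Type u} [Fintype V] [DecidableEq V] {G : SimpleGraph V} {m : V → ℤ}
  {A B : Finset V} {j : V}

/-- A component of the bipartite graph between `doubleSet m` and the rest of `B` that starts
at `j` and is bounded by vertices of odd degree. -/
structure Chain (G : SimpleGraph V) (m : V → ℤ) (B : Finset V) (j : V) (P W : Finset V) :
    Prop where
  double : ∀ p ∈ P, m p = 2
  mem : ∀ w ∈ W, w ∈ B
  even : ∀ w ∈ W, ¬ Odd (wdeg G m w)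
  adj_left : ∀ p ∈ P, ∀ v ∈ B, G.Adj p v → m v ≠ 2 ∧ (Odd (wdeg G m v) ∨ v ∈ W)
  adj_right : ∀ w ∈ W, ∀ v ∈ B, G.Adj w v → v ∈ P
  start : ∃ p ∈ P, G.Adj j p ∧ ∀ v ∈ B, G.Adj j v → m v = 2 → v = p

/-- A path in `B` alternating between `W` and `P ⊆ doubleSet m`, which starts at `j` and currently
ends at `p`. -/
structure PartialChain (G : SimpleGraph V) (N : (V → ℤ) → Prop) (m : V → ℤ) (B : Finset V)
    (j : V) (W P : Finset V) (p : V) : Prop where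
  mem : ∀ w ∈ W, w ∈ B
  one : ∀ w ∈ W, m w = 1
  start_mem : j ∈ W
  double : ∀ q ∈ P, m q = 2
  last_mem : p ∈ P
  card_eq : P.card = W.card
  top : MaxDouble N (m + ind W - ind P)
  even : ∀ w ∈ W, w ≠ j → ¬ Odd (wdeg G m w)
  adj_right : ∀ w ∈ W, w ≠ j → ∀ v ∈ B, G.Adj w v → v ∈ P
  start : ∃ q ∈ P, G.Adj j q ∧ ∀ v ∈ B, G.Adj j v → m v = 2 → v = q
  adj_double : ∀ q ∈ P, ∀ v ∈ B, G.Adj q v → m v ≠ 2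
  adj_left : ∀ q ∈ P, q ≠ p → ∀ v ∈ B, G.Adj q v → v ∈ W
  last : ∃ w ∈ W, G.Adj p w ∧ ∀ w' ∈ W, G.Adj p w' → w' = w

lemma exists_partialChain {N : (V → ℤ) → Prop} (hN : ExchangeSystem G N) (hm : MaxDouble N m)
    (hs : Split G m A B) (hjB : j ∈ B) (hodd : Odd (wdeg G m j)) :
    ∃ p, PartialChain G N m B j {j} {p} p := by
  have hj1 := hs.eq_one_of_odd hjB hodd
  obtain ⟨p, hp2, hpj, htop, hiso⟩ := hm.exists_exchange hN hj1 hodd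
  have hind : ∀ v : V, ind {v} = (Pi.single v 1 : V → ℤ) := fun v => by
    funext w
    simp [ind, Pi.single_apply]
  refine ⟨p, ⟨by simpa, by simpa, by simp, by simpa, by simp, by simp, by rwa [hind, hind],
    by simp, by simp, ⟨p, by simp, hpj.symm, fun v _ hjv hv2 => ?_⟩, ?_, by simp,
    ⟨j, by simp, hpj, by simp⟩⟩⟩
  · by_contra hvp
    exact (hiso v hv2 hvp).2 hjv.symm
  · intro q hq v _ hqv hv2
    rw [Finset.mem_singleton] at hq
    subst hq
    exact (hiso v hv2 hqv.ne').1 hqv.symm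

lemma PartialChain.extend {N : (V → ℤ) → Prop} (hN : ExchangeSystem G N) (hs : Split G m A B)
    (hodd : Odd (wdeg G m j)) {W P : Finset V} {p : V} (hc : PartialChain G N m B j W P p) :
    (∃ P' W', Chain G m B j P' W') ∨
      ∃ x p', x ∉ W ∧ PartialChain G N m B j (insert x W) (insert p' P) p' := by
  have hPB : ∀ q ∈ P, q ∈ B := fun q hq => ((hs.eq_two_iff q).1 (hc.double q hq)).2
  have hpB := hPB p hc.last_mem
  obtain ⟨w₀, hw₀, hpw₀, hw₀u⟩ := hc.last
  have hw₀B := hc.mem w₀ hw₀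
  obtain ⟨x, hx, hxw₀⟩ := Finset.exists_mem_ne (s := B.filter fun u => G.Adj p u)
    (by rw [hs.right.1.2.2 p hpB]; norm_num) w₀
  obtain ⟨hxB, hpx⟩ := Finset.mem_filter.1 hx
  have hpadj : ∀ v ∈ B, G.Adj p v → v = w₀ ∨ v = x := fun v hv hpv =>
    hs.right.1.eq_or_eq hpB hw₀B hxB hv hxw₀.symm hpw₀ hpx hpv
  have hxW : x ∉ W := fun h => hxw₀ (hw₀u x h hpx)
  have hx1 : m x = 1 := (hs.one_le hxB).resolve_right (hc.adj_double p hc.last_mem x hxB hpx)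
  have hxP : x ∉ P := fun h => by have := hc.double x h; omega
  have hjB := hc.mem j hc.start_mem
  have hj1 := hc.one j hc.start_mem
  by_cases hxo : Odd (wdeg G m x)
  · refine Or.inl ⟨P, W.erase j, hc.double, fun w hw => hc.mem w (Finset.mem_of_mem_erase hw),
      fun w hw => hc.even w (Finset.mem_of_mem_erase hw) (Finset.ne_of_mem_erase hw),
      fun q hq v hv hqv => ⟨hc.adj_double q hq v hv hqv, ?_⟩,
      fun w hw => hc.adj_right w (Finset.mem_of_mem_erase hw) (Finset.ne_of_mem_erase hw),
      hc.start⟩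
    have hW : v ∈ W → Odd (wdeg G m v) ∨ v ∈ W.erase j := fun hvW => by
      by_cases hvj : v = j
      · exact Or.inl (hvj ▸ hodd)
      · exact Or.inr (Finset.mem_erase.2 ⟨hvj, hvW⟩)
    by_cases hqp : q = p
    · subst hqp
      rcases hpadj v hv hqv with rfl | rfl
      exacts [hW hw₀, Or.inl hxo]
    · exact hW (hc.adj_left q hq hqp v hv hqv)
  -- `x` has no neighbor in `W`, as otherwise `B` would be an odd hole
  have hWx : ∀ w ∈ W, ¬ G.Adj w x := by
    intro w hw hwx
    by_cases hwj : w = j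
    · subst hwj
      obtain ⟨q, hqP, hwq, -⟩ := hc.start
      have hqB := hPB q hqP
      have hqx : q ≠ x := fun h => hxP (h ▸ hqP)
      have hwp : w ≠ p := fun h => by have := hc.double p hc.last_mem; rw [← h] at this; omega
      have hS : insert x (P ∪ W) = B := by
        refine hs.right.1.eq_of_closed ?_ ⟨x, Finset.mem_insert_self _ _⟩ ?_
        · intro t ht
          rcases Finset.mem_insert.1 ht with rfl | ht
          · exact hxB
          · exact (Finset.mem_union.1 ht).elim (hPB t) (hc.mem t)
        · intro s hS t ht hst
          rw [Finset.mem_insert, Finset.mem_union] at hS ⊢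
          rcases hS with rfl | hsP | hsW
          · rcases hs.right.1.eq_or_eq hxB hjB hpB ht hwp hwx.symm hpx.symm hst with rfl | rfl
            exacts [Or.inr (Or.inr hw), Or.inr (Or.inl hc.last_mem)]
          · by_cases hsp : s = p
            · subst hsp
              rcases hpadj t ht hst with rfl | rfl
              exacts [Or.inr (Or.inr hw₀), Or.inl rfl]
            · exact Or.inr (Or.inr (hc.adj_left s hsP hsp t ht hst))
          · by_cases hsw : s = w
            · subst hsw
              rcases hs.right.1.eq_or_eq hjB hqB hxB ht hqx hwq hwx hst with rfl | rfl
              exacts [Or.inr (Or.inl hqP), Or.inl rfl]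
            · exact Or.inr (Or.inl (hc.adj_right s hsW hsw t ht hst))
      have hdisj : Disjoint P W := Finset.disjoint_left.2 fun t h1 h2 => by
        have := hc.double t h1
        have := hc.one t h2
        omega
      have hcard : B.card = 2 * W.card + 1 := by
        rw [← hS, Finset.card_insert_of_notMem (by simp [hxP, hxW]),
          Finset.card_union_of_disjoint hdisj, hc.card_eq, two_mul]
      have heven := hs.right.2
      rw [hcard] at heven
      exact absurd heven (by simp)
    · have := hc.double x (hc.adj_right w hw hwj x hxB hwx)
      omega
  have hval : ∀ v, (m + ind W - ind P : V → ℤ) v =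
      m v + (if v ∈ W then 1 else 0) - if v ∈ P then 1 else 0 := fun v => by simp [ind]
  have hxdeg : Odd (wdeg G (m + ind W - ind P) x) := by
    have h1 : (W.filter fun u => G.Adj x u) = ∅ :=
      Finset.filter_false_of_mem fun w hw h => hWx w hw h.symm
    have h2 : (P.filter fun u => G.Adj x u) = {p} := by
      ext q
      rw [Finset.mem_filter, Finset.mem_singleton]
      constructor
      · rintro ⟨hq, hxq⟩
        by_contra hqp
        exact hxW (hc.adj_left q hq hqp x hxB hxq.symm)
      · rintro rfl
        exact ⟨hc.last_mem, hpx.symm⟩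
    rw [wdeg_sub, wdeg_add, wdeg_ind, wdeg_ind, h1, h2]
    simpa using (Int.not_odd_iff_even.1 hxo).sub_odd odd_one
  obtain ⟨p', hp', hp'x, htop, hiso⟩ := hc.top.exists_exchange hN
    (by rw [hval, if_neg hxW, if_neg hxP]; omega) hxdeg
  rw [hval] at hp'
  have hp'W : p' ∉ W := fun h => hWx p' h hp'x
  have hp'P : p' ∉ P := fun h => by
    have := hc.double p' h
    rw [if_neg hp'W, if_pos h] at hp'
    omega
  have hp'2 : m p' = 2 := by
    rw [if_neg hp'W, if_neg hp'P] at hp'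
    omega
  have hp'B : p' ∈ B := ((hs.eq_two_iff p').1 hp'2).2
  have hpp' : p ≠ p' := fun h => hp'P (h ▸ hc.last_mem)
  refine Or.inr ⟨x, p', hxW, ?_⟩
  refine ⟨?_, ?_, Finset.mem_insert_of_mem hc.start_mem, ?_, Finset.mem_insert_self _ _, ?_, ?_,
    ?_, ?_, ?_, ?_, ?_, ⟨x, Finset.mem_insert_self _ _, hp'x, ?_⟩⟩
  · exact (Finset.forall_mem_insert _ _ _).2 ⟨hxB, hc.mem⟩
  · exact (Finset.forall_mem_insert _ _ _).2 ⟨hx1, hc.one⟩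
  · exact (Finset.forall_mem_insert _ _ _).2 ⟨hp'2, hc.double⟩
  · rw [Finset.card_insert_of_notMem hp'P, Finset.card_insert_of_notMem hxW, hc.card_eq]
  · rw [ind_insert hxW, ind_insert hp'P]
    convert htop using 1
    abel
  · exact (Finset.forall_mem_insert _ _ _).2 ⟨fun _ => hxo, hc.even⟩
  · refine (Finset.forall_mem_insert _ _ _).2 ⟨fun _ v hv hxv => ?_,
      fun w hw hwj v hv hwv => Finset.mem_insert_of_mem (hc.adj_right w hw hwj v hv hwv)⟩
    rcases hs.right.1.eq_or_eq hxB hpB hp'B hv hpp' hpx.symm hp'x.symm hxv with rfl | rfl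
    exacts [Finset.mem_insert_of_mem hc.last_mem, Finset.mem_insert_self _ _]
  · obtain ⟨q, hq, hjq⟩ := hc.start
    exact ⟨q, Finset.mem_insert_of_mem hq, hjq⟩
  · refine (Finset.forall_mem_insert _ _ _).2 ⟨fun v hv hp'v hv2 => ?_, hc.adj_double⟩
    by_cases hvP : v ∈ P
    · exact hc.adj_double v hvP p' hp'B hp'v.symm hp'2
    · have hvW : v ∉ W := fun h => by have := hc.one v h; omega
      exact (hiso v (by rw [hval, if_neg hvW, if_neg hvP]; omega) hp'v.ne').1 hp'v.symm
  · refine (Finset.forall_mem_insert _ _ _).2 ⟨fun h => absurd rfl h, fun q hq _ v hv hqv => ?_⟩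
    by_cases hqp : q = p
    · subst hqp
      rcases hpadj v hv hqv with rfl | rfl
      exacts [Finset.mem_insert_of_mem hw₀, Finset.mem_insert_self _ _]
    · exact Finset.mem_insert_of_mem (hc.adj_left q hq hqp v hv hqv)
  · refine (Finset.forall_mem_insert _ _ _).2 ⟨fun _ => rfl, fun w hw hp'w => ?_⟩
    exfalso
    by_cases hwj : w = j
    · subst hwj
      obtain ⟨q, hq, -, hqu⟩ := hc.start
      exact hp'P (hqu p' hp'B hp'w.symm hp'2 ▸ hq)
    · exact hp'P (hc.adj_right w hw hwj p' hp'B hp'w.symm)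

lemma PartialChain.exists_chain {N : (V → ℤ) → Prop} (hN : ExchangeSystem G N)
    (hs : Split G m A B) (hodd : Odd (wdeg G m j)) {W P : Finset V} {p : V}
    (hc : PartialChain G N m B j W P p) : ∃ P' W', Chain G m B j P' W' := by
  induction hn : Fintype.card V - W.card using Nat.strong_induction_on generalizing W P p with
  | _ n ih =>
    rcases hc.extend hN hs hodd with hdone | ⟨x, p', hxW, hc'⟩
    · exact hdone
    · have h1 := Finset.card_le_univ (insert x W)
      rw [Finset.card_insert_of_notMem hxW] at h1
      refine ih (Fintype.card V - (insert x W).card) ?_ hc' rfl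
      rw [Finset.card_insert_of_notMem hxW]
      omega

/-- The number of vertices of `B` of odd degree is even, by counting the edges of all chains. -/
lemma even_card_of_chains (hs : Split G m A B)
    (hch : ∀ j ∈ B, Odd (wdeg G m j) → ∃ P W, Chain G m B j P W) :
    Even (B.filter fun v => Odd (wdeg G m v)).card := by
  set O := B.filter fun v => Odd (wdeg G m v) with hO
  have hO' : ∀ j ∈ O, ∃ P W, Chain G m B j P W := fun j hj =>
    hch j (Finset.mem_filter.1 hj).1 (Finset.mem_filter.1 hj).2
  choose! P W hPW using hO'
  set Ps := O.biUnion P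
  set Ws := O.biUnion W
  have hdisj : Disjoint Ws O := by
    refine Finset.disjoint_left.2 fun w hw hwO => ?_
    obtain ⟨j, hj, hwj⟩ := Finset.mem_biUnion.1 hw
    exact (hPW j hj).even w hwj (Finset.mem_filter.1 hwO).2
  have hPs2 : ∀ p ∈ Ps, m p = 2 := fun p hp => by
    obtain ⟨j, hj, hpj⟩ := Finset.mem_biUnion.1 hp
    exact (hPW j hj).double p hpj
  have hPsB : ∀ p ∈ Ps, p ∈ B := fun p hp => ((hs.eq_two_iff p).1 (hPs2 p hp)).2
  have hleft : ∀ p ∈ Ps, ((Ws ∪ O).filter fun u => G.Adj p u).card = 2 := by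
    intro p hp
    rw [← hs.right.1.2.2 p (hPsB p hp)]
    congr 1
    ext v
    simp only [Finset.mem_filter]
    refine and_congr_left fun hpv => ⟨fun hv => ?_, fun hv => ?_⟩
    · rcases Finset.mem_union.1 hv with hv | hv
      · obtain ⟨j, hj, hvj⟩ := Finset.mem_biUnion.1 hv
        exact (hPW j hj).mem v hvj
      · exact (Finset.mem_filter.1 hv).1
    · obtain ⟨j, hj, hpj⟩ := Finset.mem_biUnion.1 hp
      rcases ((hPW j hj).adj_left p hpj v hv hpv).2 with ho | hvW
      · exact Finset.mem_union_right _ (Finset.mem_filter.2 ⟨hv, ho⟩)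
      · exact Finset.mem_union_left _ (Finset.mem_biUnion.2 ⟨j, hj, hvW⟩)
  have hright : ∀ w ∈ Ws, (Ps.filter fun u => G.Adj u w).card = 2 := by
    intro w hw
    obtain ⟨j, hj, hwj⟩ := Finset.mem_biUnion.1 hw
    rw [← hs.right.1.2.2 w ((hPW j hj).mem w hwj)]
    congr 1
    ext v
    simp only [Finset.mem_filter, G.adj_comm w]
    exact and_congr_left fun hwv => ⟨hPsB v, fun hv =>
      Finset.mem_biUnion.2 ⟨j, hj, (hPW j hj).adj_right w hwj v hv hwv.symm⟩⟩
  have hstart : ∀ j ∈ O, (Ps.filter fun u => G.Adj u j).card = 1 := by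
    intro j hj
    obtain ⟨p, hp, hjp, hu⟩ := (hPW j hj).start
    refine Finset.card_eq_one.2 ⟨p, ?_⟩
    ext v
    rw [Finset.mem_filter, Finset.mem_singleton]
    constructor
    · exact fun hv => hu v (hPsB v hv.1) hv.2.symm (hPs2 v hv.1)
    · rintro rfl
      exact ⟨Finset.mem_biUnion.2 ⟨j, hj, hp⟩, hjp.symm⟩
  have hcount := Finset.sum_card_bipartiteAbove_eq_sum_card_bipartiteBelow
    (s := Ps) (t := Ws ∪ O) G.Adj
  unfold Finset.bipartiteAbove Finset.bipartiteBelow at hcount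
  rw [Finset.sum_union hdisj, Finset.sum_congr rfl hleft, Finset.sum_congr rfl hright,
    Finset.sum_congr rfl hstart] at hcount
  simp only [Finset.sum_const, smul_eq_mul, mul_one] at hcount
  exact ⟨Ps.card - Ws.card, by omega⟩

lemma ExchangeSystem.not {N : (V → ℤ) → Prop} (hN : ExchangeSystem G N) (m₀ : V → ℤ) :
    ¬ N m₀ := by
  intro h₀
  obtain ⟨m, hm⟩ := exists_maxDouble h₀
  obtain ⟨A, B, hs, hodd⟩ := hN.split m hm.1
  have heven := even_card_of_chains hs fun j hj ho => by
    obtain ⟨p, hp⟩ := exists_partialChain hN hm hs hj ho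
    exact hp.exists_chain hN hs ho
  rw [Finset.odd_sum_iff_odd_card_odd] at hodd
  refine Nat.not_even_iff_odd.2 hodd ?_
  convert heven using 2
  refine Finset.filter_congr fun v hv => ?_
  rw [hs.wdeg_eq, hs.right.1.2.2 v hv, ← Nat.cast_add, Int.odd_coe_nat, Nat.odd_add]
  simp

end Chains

lemma sum_commComponent {V : Type u} [Fintype V] [DecidableEq V] {d : ℕ} {G : SimpleGraph V}
    {h : V → Matrix (Fin d) (Fin d) ℂ} {K K' : Finset (Finset V)}
    (h0 : ∀ m, commComponent G h K K' m = 0) :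
    ∑ A ∈ K, ∑ B ∈ K', ⁅holeOp G h A, holeOp G h B⁆ = 0 := by
  let S := (K ×ˢ K').image fun p => ind p.1 + ind p.2
  have : ∑ m ∈ S, commComponent G h K K' m = 0 := Finset.sum_eq_zero fun m _ => h0 m
  refine Eq.trans ?_ this
  simp only [commComponent]
  rw [Finset.sum_comm (s := S)]
  refine Finset.sum_congr rfl fun A hA => ?_
  rw [Finset.sum_comm (s := S)]
  refine Finset.sum_congr rfl fun B hB => ?_
  refine ((Finset.sum_eq_single (ind A + ind B) ?_ ?_).trans ?_).symm
  · intro m _ hm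
    rw [if_neg hm.symm, zero_smul]
  · intro hm
    exact absurd (Finset.mem_image.2 ⟨(A, B), Finset.mem_product.2 ⟨hA, hB⟩, rfl⟩) hm
  · simp

/-- Theorem 1(iii): for a claw-free graph with an operator realization, the generalized cycle
symmetries commute with one another. -/
theorem cycleSymms_commute {V : Type u} [Fintype V] [DecidableEq V]
    (G : SimpleGraph V) (hcf : ClawFree G) (d : ℕ) (hd : 0 < d)
    (h : V → Matrix (Fin d) (Fin d) ℂ) (b : V → ℝ) (hb : ∀ v, b v ≠ 0)
    (hsq : ∀ v, h v * h v = ((b v : ℂ)) ^ 2 • (1 : Matrix (Fin d) (Fin d) ℂ))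
    (hanti : ∀ u v, G.Adj u v → h u * h v = -(h v * h u))
    (hcomm : ∀ u v, u ≠ v → ¬ G.Adj u v → h u * h v = h v * h u)
    (C₀ C₀' : Finset V) (hC₀ : IsEvenHole G C₀) (hC₀' : IsEvenHole G C₀') :
    cycleSymm G h C₀ * cycleSymm G h C₀' = cycleSymm G h C₀' * cycleSymm G h C₀ := by
  have hr : IsRealization G h :=
    { sq := fun v => ⟨(b v : ℂ) ^ 2, pow_ne_zero 2 (Complex.ofReal_ne_zero.2 (hb v)), hsq v⟩
      anti := hanti
      comm := hcomm }
  have hK := twinClosed_deformClosure G C₀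
  have hK' := twinClosed_deformClosure G C₀'
  have hN : ExchangeSystem G fun m =>
      commComponent G h (deformClosure G C₀) (deformClosure G C₀') m ≠ 0 :=
    { split := fun m hm => by
        obtain ⟨A, hA, B, hB, hAB, hodd⟩ := commComponent_ne_zero hr hm
        exact ⟨A, B, ⟨(hK.isEvenHole A hA).1, hK'.isEvenHole B hB, hAB⟩, hodd⟩
      exchange := fun m j hm hj => exists_exchange hcf hr hK hK' hm hj }
  have hsum := sum_commComponent (fun m => not_not.1 (hN.not m))
  simp only [Ring.lie_def, Finset.sum_sub_distrib] at hsum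
  rw [cycleSymm, cycleSymm, Finset.sum_mul_sum, Finset.sum_mul_sum,
    Finset.sum_comm (s := deformClosure G C₀')]
  exact sub_eq_zero.1 hsum
end
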